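/- arXiv:2011.06586 — 4 statements merged into one kernel-verified Lean document; each statement's English description precedes it below -/
import Mathlib

section
/- Define S(X) = Σ d(x1*x2*x3) / (x1*x2*x3), where the sum is over all triples (x1, x2, x3) of pairwise coprime squarefree positive integers with x1*x2*x3 ≤ X such that the quadratic form x1*y1^2 + x2*y2^2 - x3*y3^2 has a nontrivial rational zero (equivalently, a nonzero integer zero). Then S(X) = O((log X)^3) as X → ∞; that is, there exist constants C > 0 and X0 ≥ 2 such that S(X) ≤ C * (log X)^3 for all X ≥ X0. -/
open Real

open scoped Classical in
/-- `S(X) = Σ d(x1*x2*x3)/(x1*x2*x3)` over triples of pairwise coprime squarefree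
positive integers with product at most `X` such that the form
`x1*y1² + x2*y2² - x3*y3²` has a nontrivial integer zero. -/
noncomputable def solubleFormSum (X : ℝ) : ℝ :=
  ∑ t ∈ (Finset.Icc 1 ⌊X⌋₊) ×ˢ (Finset.Icc 1 ⌊X⌋₊) ×ˢ (Finset.Icc 1 ⌊X⌋₊),
    if Nat.Coprime t.1 t.2.1 ∧ Nat.Coprime t.1 t.2.2 ∧ Nat.Coprime t.2.1 t.2.2 ∧
        Squarefree t.1 ∧ Squarefree t.2.1 ∧ Squarefree t.2.2 ∧
        ((t.1 * t.2.1 * t.2.2 : ℕ) : ℝ) ≤ X ∧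
        (∃ y1 y2 y3 : ℤ, (y1, y2, y3) ≠ (0, 0, 0) ∧
          (t.1 : ℤ) * y1 ^ 2 + (t.2.1 : ℤ) * y2 ^ 2 = (t.2.2 : ℤ) * y3 ^ 2)
    then ((t.1 * t.2.1 * t.2.2).divisors.card : ℝ) / ((t.1 * t.2.1 * t.2.2 : ℕ) : ℝ)
    else 0

def TernaryPrimitive (y1 y2 y3 : ℤ) : Prop :=
  ∀ d : ℤ, d ∣ y1 → d ∣ y2 → d ∣ y3 → IsUnit d

lemma TernaryPrimitive.rotate {y1 y2 y3 : ℤ} (h : TernaryPrimitive y1 y2 y3) :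
    TernaryPrimitive y2 y3 y1 := fun d h2 h3 h1 => h d h1 h2 h3

lemma TernaryPrimitive.swap {y1 y2 y3 : ℤ} (h : TernaryPrimitive y1 y2 y3) :
    TernaryPrimitive y1 y3 y2 := fun d h1 h3 h2 => h d h1 h2 h3

lemma isCoprime_of_ternary_zero {a b c y1 y2 y3 : ℤ} (ha : Squarefree a)
    (h : a * y1 ^ 2 + b * y2 ^ 2 + c * y3 ^ 2 = 0) (hy : TernaryPrimitive y1 y2 y3) :
    IsCoprime y2 y3 := by
  have key : ∀ p : ℤ, Prime p → p ∣ y2 → ¬ p ∣ y3 := by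
    rintro p hp ⟨s, hs⟩ ⟨t, ht⟩
    by_cases h1 : p ∣ y1
    · exact hp.not_isUnit (hy p h1 ⟨s, hs⟩ ⟨t, ht⟩)
    have hd : p * p ∣ a * y1 ^ 2 := ⟨-(b * s ^ 2 + c * t ^ 2), by rw [hs, ht] at h; linarith⟩
    have hco : IsCoprime (p * p) (y1 ^ 2) := by
      have := (hp.irreducible.coprime_iff_not_dvd).2 h1
      exact IsCoprime.mul_left this.pow_right this.pow_right
    exact hp.not_isUnit (ha p (hco.dvd_of_dvd_mul_right hd))
  refine isCoprime_of_prime_dvd ?_ key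
  rintro ⟨h2, h3⟩
  exact key 2 Int.prime_two (by simp [h2]) (by simp [h3])

lemma isCoprime_coeff_of_ternary_zero {a b c y1 y2 y3 : ℤ} (ha : Squarefree a)
    (hac : IsCoprime a c)
    (h : a * y1 ^ 2 + b * y2 ^ 2 + c * y3 ^ 2 = 0) (hy : TernaryPrimitive y1 y2 y3) :
    IsCoprime a y2 := by
  refine isCoprime_of_prime_dvd (fun h0 => ha.ne_zero h0.1) fun p hp hpa hp2 => ?_
  have hd : p ∣ c * y3 ^ 2 := by
    have : c * y3 ^ 2 = -(a * y1 ^ 2 + b * y2 ^ 2) := by linarith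
    rw [this, dvd_neg]
    exact dvd_add (hpa.mul_right _) ((hp2.pow two_ne_zero).mul_left _)
  have hpc : ¬ p ∣ c := fun hc => hp.not_isUnit (hac.isUnit_of_dvd' hpa hc)
  have h3 : p ∣ y3 := hp.dvd_of_dvd_pow ((hp.dvd_or_dvd hd).resolve_left hpc)
  exact hp.not_isUnit ((isCoprime_of_ternary_zero ha h hy).isUnit_of_dvd' hp2 h3)

lemma dvd_ternary_of_congr {a b c e1 e2 e3 y1 y2 y3 d s : ℤ} (hda : d ∣ a)
    (hco : IsCoprime d e3) (he : a * e1 ^ 2 + b * e2 ^ 2 + c * e3 ^ 2 = 0) (hs : s ^ 2 = 1)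
    (hd : d ∣ y2 * e3 - s * y3 * e2) : d ∣ a * y1 ^ 2 + b * y2 ^ 2 + c * y3 ^ 2 := by
  refine (hco.pow_right (n := 2)).dvd_of_dvd_mul_right ?_
  have : (a * y1 ^ 2 + b * y2 ^ 2 + c * y3 ^ 2) * e3 ^ 2 =
      a * (y1 ^ 2 * e3 ^ 2 - e1 ^ 2 * y3 ^ 2)
        + (y2 * e3 - s * y3 * e2) * (b * (y2 * e3 + s * y3 * e2)) := by
    linear_combination y3 ^ 2 * he + b * y3 ^ 2 * e2 ^ 2 * hs
  rw [this]
  exact dvd_add (hda.mul_right _) (hd.mul_right _)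

lemma four_dvd_ternary_aux {a b c e1 e2 e3 : ℤ} 
    (he : a * e1 ^ 2 + b * e2 ^ 2 + c * e3 ^ 2 = 0) (h1 : Even e1) (h2 : Odd e2) (h3 : Odd e3)
    {y1 y2 y3 : ℤ} (hy1 : 2 ∣ y1) (hy2 : 2 ∣ y2 + y3) :
    4 ∣ a * y1 ^ 2 + b * y2 ^ 2 + c * y3 ^ 2 := by
  obtain ⟨s, rfl⟩ := hy1
  obtain ⟨t, ht⟩ := hy2
  obtain rfl : y2 = 2 * t - y3 := by linarith
  obtain ⟨f1, rfl⟩ := h1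
  obtain ⟨f2, rfl⟩ := h2
  obtain ⟨f3, rfl⟩ := h3
  have hbc : 4 ∣ b + c :=
    ⟨-(a * f1 ^ 2 + b * (f2 ^ 2 + f2) + c * (f3 ^ 2 + f3)), by linear_combination he⟩
  obtain ⟨m, hm⟩ := hbc
  exact ⟨a * s ^ 2 + b * (t ^ 2 - t * y3) + m * y3 ^ 2, by linear_combination y3 ^ 2 * hm⟩

lemma exists_forms_odd {a b c e1 e2 e3 : ℤ} (ha : Odd a) (hb : Odd b) (hc : Odd c)
    (he : a * e1 ^ 2 + b * e2 ^ 2 + c * e3 ^ 2 = 0) (hp : TernaryPrimitive e1 e2 e3) :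
    ∃ u1 u2 u3 v1 v2 v3 : ℤ, ∀ y1 y2 y3 : ℤ, 2 ∣ u1 * y1 + u2 * y2 + u3 * y3 →
      2 ∣ v1 * y1 + v2 * y2 + v3 * y3 → 4 ∣ a * y1 ^ 2 + b * y2 ^ 2 + c * y3 ^ 2 := by
  have hpar : Even (a * e1 ^ 2 + b * e2 ^ 2 + c * e3 ^ 2) := by simp [he]
  have hnot : ¬ (Even e1 ∧ Even e2 ∧ Even e3) := fun h => by
    have := hp 2 h.1.two_dvd h.2.1.two_dvd h.2.2.two_dvd
    simp [Int.isUnit_iff] at this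
  simp only [Int.even_add, Int.even_mul, Int.even_pow, Int.not_even_iff_odd.2 ha,
    Int.not_even_iff_odd.2 hb, Int.not_even_iff_odd.2 hc] at hpar
  by_cases h1 : Even e1
  · have h2 : ¬ Even e2 := by tauto
    have h3 : ¬ Even e3 := by tauto
    refine ⟨1, 0, 0, 0, 1, 1, fun y1 y2 y3 hu hv => ?_⟩
    exact four_dvd_ternary_aux he h1 (Int.not_even_iff_odd.1 h2) (Int.not_even_iff_odd.1 h3)
      (by simpa using hu) (by simpa using hv)
  by_cases h2 : Even e2
  · have h3 : ¬ Even e3 := by tauto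
    refine ⟨0, 1, 0, 1, 0, 1, fun y1 y2 y3 hu hv => ?_⟩
    have := four_dvd_ternary_aux (y1 := y2) (y2 := y1) (y3 := y3)
      (by linarith : b * e2 ^ 2 + a * e1 ^ 2 + c * e3 ^ 2 = 0) h2
      (Int.not_even_iff_odd.1 h1) (Int.not_even_iff_odd.1 h3)
      (by simpa using hu) (by simpa using hv)
    convert this using 1; ring
  · have h3 : Even e3 := by tauto
    refine ⟨0, 0, 1, 1, 1, 0, fun y1 y2 y3 hu hv => ?_⟩
    have := four_dvd_ternary_aux (y1 := y3) (y2 := y1) (y3 := y2)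
      (by linarith : c * e3 ^ 2 + a * e1 ^ 2 + b * e2 ^ 2 = 0) h3
      (Int.not_even_iff_odd.1 h1) (Int.not_even_iff_odd.1 h2)
      (by simpa using hu) (by simpa using hv)
    convert this using 1; ring

lemma eight_dvd_ternary {a b c e1 e2 e3 : ℤ} (ha : Even a)
    (he : a * e1 ^ 2 + b * e2 ^ 2 + c * e3 ^ 2 = 0) (h3 : IsCoprime a e3) {y1 y2 y3 : ℤ}
    (hu : 4 ∣ y2 * e3 - y3 * e2) (hv : 2 ∣ y1 * e3 - y3 * e1) :
    8 ∣ a * y1 ^ 2 + b * y2 ^ 2 + c * y3 ^ 2 := by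
  obtain ⟨t, ht⟩ := hu
  obtain ⟨s, hs⟩ := hv
  have hco : IsCoprime (8 : ℤ) (e3 ^ 2) := by
    have := (h3.of_isCoprime_of_dvd_left ha.two_dvd).pow (m := 3) (n := 2)
    norm_num at this
    exact this
  obtain ⟨a', rfl⟩ := ha.two_dvd
  refine hco.dvd_of_dvd_mul_right
    ⟨a' * (s * y3 * e1 + s ^ 2) + b * (t * y3 * e2 + 2 * t ^ 2), ?_⟩
  linear_combination y3 ^ 2 * he + b * (y2 * e3 + y3 * e2 + 4 * t) * ht +
    2 * a' * (y1 * e3 + y3 * e1 + 2 * s) * hs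

lemma exists_two_adic_forms {a b c e1 e2 e3 : ℤ} {t : ℕ} (ha : Squarefree a) (hb : Squarefree b)
    (hc : Squarefree c) (hab : IsCoprime a b) (hbc : IsCoprime b c)
    (ht : (t = 1 ∧ Odd a ∧ Odd b ∧ Odd c) ∨ (t = 2 ∧ (Even a ∨ Even b ∨ Even c)))
    (he : a * e1 ^ 2 + b * e2 ^ 2 + c * e3 ^ 2 = 0) (hp : TernaryPrimitive e1 e2 e3) :
    ∃ u1 u2 u3 v1 v2 v3 : ℤ, ∀ y1 y2 y3 : ℤ,
      ((2 * t : ℕ) : ℤ) ∣ u1 * y1 + u2 * y2 + u3 * y3 →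
      2 ∣ v1 * y1 + v2 * y2 + v3 * y3 →
      ((4 * t : ℕ) : ℤ) ∣ a * y1 ^ 2 + b * y2 ^ 2 + c * y3 ^ 2 := by
  rcases ht with ⟨rfl, h1, h2, h3⟩ | ⟨rfl, h | h | h⟩
  · simpa using exists_forms_odd h1 h2 h3 he hp
  · refine ⟨0, e3, -e2, e3, 0, -e1, fun y1 y2 y3 hu hv => ?_⟩
    have hco : IsCoprime a e3 := isCoprime_coeff_of_ternary_zero (c := b) (b := c) (y1 := e1)
      (y3 := e2) ha hab (by linarith) hp.swap
    push_cast at hu ⊢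
    ring_nf at hu hv
    exact eight_dvd_ternary h he hco (by convert hu using 1; ring) hv
  · refine ⟨e3, 0, -e1, 0, e3, -e2, fun y1 y2 y3 hu hv => ?_⟩
    have hco : IsCoprime b e3 := isCoprime_coeff_of_ternary_zero (c := a) (b := c) (y1 := e2)
      (y3 := e1) hb hab.symm (by linarith) hp.rotate
    push_cast at hu ⊢
    ring_nf at hu hv
    have := eight_dvd_ternary (a := b) (b := a) (c := c) (e1 := e2) (e2 := e1) (y1 := y2)
      (y2 := y1) (y3 := y3) h
      (by linarith) hco (by convert hu using 1; ring) (by convert hv using 1; ring)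
    convert this using 1; ring
  · refine ⟨-e2, e1, 0, -e3, 0, e1, fun y1 y2 y3 hu hv => ?_⟩
    have hco : IsCoprime c e1 := isCoprime_coeff_of_ternary_zero (c := b) (b := a) (y1 := e3)
      (y3 := e2) hc hbc.symm (by linarith) hp.rotate.rotate
    push_cast at hu ⊢
    ring_nf at hu hv
    have := eight_dvd_ternary (a := c) (b := b) (c := a) (e1 := e3) (e2 := e2) (y1 := y3)
      (y2 := y2) (y3 := y1) h
      (by linarith) hco (by convert hu using 1; ring) (by convert hv using 1; ring)
    convert this using 1; ring

theorem exists_small_of_prod_lt {ι : Type*} [Fintype ι] (m : ι → ℕ) (hm : ∀ j, m j ≠ 0)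
    (u : ι → ℤ × ℤ × ℤ) (N1 N2 N3 : ℕ) (h : ∏ j, m j < N1 * N2 * N3) :
    ∃ y1 y2 y3 : ℤ, ¬ (y1 = 0 ∧ y2 = 0 ∧ y3 = 0) ∧ |y1| < N1 ∧ |y2| < N2 ∧ |y3| < N3 ∧
      ∀ j, (m j : ℤ) ∣ (u j).1 * y1 + (u j).2.1 * y2 + (u j).2.2 * y3 := by
  classical
  have : ∀ j, NeZero (m j) := fun j => ⟨hm j⟩
  let f : ℕ × ℕ × ℕ → ∀ j, ZMod (m j) := fun y j =>
    (((u j).1 * y.1 + (u j).2.1 * y.2.1 + (u j).2.2 * y.2.2 : ℤ) : ZMod (m j))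
  obtain ⟨x, hx, y, hy, hxy, hf⟩ := Finset.exists_ne_map_eq_of_card_lt_of_maps_to
    (s := Finset.range N1 ×ˢ Finset.range N2 ×ˢ Finset.range N3) (t := Finset.univ) (f := f)
    (by
      rw [Finset.card_univ, Fintype.card_pi]
      simpa [ZMod.card, mul_assoc] using h) (fun _ _ => Finset.mem_coe.2 (Finset.mem_univ _))
  obtain ⟨x1, x2, x3⟩ := x
  obtain ⟨y1, y2, y3⟩ := y
  simp only [Finset.mem_product, Finset.mem_range] at hx hy
  refine ⟨y1 - x1, y2 - x2, y3 - x3, ?_, ?_, ?_, ?_, fun j => ?_⟩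
  · rintro ⟨h1, h2, h3⟩
    apply hxy
    simp only [Prod.mk.injEq]
    omega
  · rw [abs_lt]; omega
  · rw [abs_lt]; omega
  · rw [abs_lt]; omega
  · have := congrFun hf j
    simp only [f] at this
    rw [ZMod.intCast_eq_intCast_iff_dvd_sub] at this
    convert this using 1
    ring

lemma lt_prod_sqrt {x1 x2 x3 : ℕ} (h1 : Squarefree x1) (h2 : Squarefree x2) (h3 : x3 ≠ 0)
    (h12 : Nat.Coprime x1 x2) (hne : ¬ (x1 = 1 ∧ x2 = 1)) :
    4 * (x1 * x2 * x3) < (Nat.sqrt (2 * x2 * x3 - 1) + 1) * (Nat.sqrt (2 * x1 * x3 - 1) + 1) *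
      (Nat.sqrt (4 * x1 * x2 - 1) + 1) := by
  have hx1 := Nat.pos_of_ne_zero h1.ne_zero
  have hx2 := Nat.pos_of_ne_zero h2.ne_zero
  have hx3 := Nat.pos_of_ne_zero h3
  have hA : 2 * x2 * x3 ≤ (Nat.sqrt (2 * x2 * x3 - 1) + 1) ^ 2 := by
    have := Nat.lt_succ_sqrt' (2 * x2 * x3 - 1)
    rw [Nat.succ_eq_add_one] at this; omega
  have hB : 2 * x1 * x3 ≤ (Nat.sqrt (2 * x1 * x3 - 1) + 1) ^ 2 := by
    have := Nat.lt_succ_sqrt' (2 * x1 * x3 - 1)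
    rw [Nat.succ_eq_add_one] at this; omega
  have hC : 4 * x1 * x2 ≤ (Nat.sqrt (4 * x1 * x2 - 1) + 1) ^ 2 := by
    have := Nat.lt_succ_sqrt' (4 * x1 * x2 - 1)
    rw [Nat.succ_eq_add_one] at this; omega
  generalize Nat.sqrt (2 * x2 * x3 - 1) + 1 = A at *
  generalize Nat.sqrt (2 * x1 * x3 - 1) + 1 = B at *
  generalize Nat.sqrt (4 * x1 * x2 - 1) + 1 = C at *
  have hC' : 4 * x1 * x2 < C ^ 2 := by
    refine lt_of_le_of_ne hC fun heq => hne ?_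
    have h2C : 2 ∣ C := Nat.prime_two.dvd_of_dvd_pow (n := 2) ⟨2 * x1 * x2, by rw [← heq]; ring⟩
    obtain ⟨m, rfl⟩ := h2C
    have hm : x1 * x2 = m ^ 2 := by nlinarith
    have hsq : Squarefree (x1 * x2) := (Nat.squarefree_mul h12).2 ⟨h1, h2⟩
    have : IsUnit m := hsq m ⟨1, by rw [hm]; ring⟩
    rw [Nat.isUnit_iff] at this
    subst this
    simpa using hm
  refine lt_of_pow_lt_pow_left₀ 2 (Nat.zero_le _) ?_
  calc (4 * (x1 * x2 * x3)) ^ 2 = (2 * x2 * x3) * (2 * x1 * x3) * (4 * x1 * x2) := by ring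
    _ < A ^ 2 * B ^ 2 * C ^ 2 := by
      refine Nat.mul_lt_mul_of_le_of_lt (Nat.mul_le_mul hA hB) hC' ?_
      exact Nat.mul_pos (lt_of_lt_of_le (by positivity) hA) (lt_of_lt_of_le (by positivity) hB)
    _ = _ := by ring

lemma abs_ternary_lt {a b c y1 y2 y3 : ℤ} (ha : 0 < a) (hb : 0 < b) (hc : 0 < c)
    (h1 : y1 ^ 2 < 2 * b * c) (h2 : y2 ^ 2 < 2 * a * c) (h3 : y3 ^ 2 < 4 * a * b) :
    |a * y1 ^ 2 + b * y2 ^ 2 + -c * y3 ^ 2| < 4 * (a * b * c) := by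
  have r1 := mul_lt_mul_of_pos_left h1 ha
  have r2 := mul_lt_mul_of_pos_left h2 hb
  have r3 := mul_lt_mul_of_pos_left h3 hc
  have l1 : 0 ≤ a * y1 ^ 2 := by positivity
  have l2 : 0 ≤ b * y2 ^ 2 := by positivity
  have l3 : 0 ≤ c * y3 ^ 2 := by positivity
  rw [abs_lt]
  constructor <;> linarith

/-- A squarefree number split as `t * (D * E)` with `t` its even part. -/
structure OddSplit (x t D E : ℕ) : Prop where
  eq : x = t * (D * E)
  odd : Odd (D * E)
  two : t = 1 ∨ t = 2

theorem exists_ternary_zero_of_split {x1 x2 x3 t1 t2 t3 D1 E1 D2 E2 D3 E3 : ℕ}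
    (h1 : Squarefree x1) (h2 : Squarefree x2) (h3 : Squarefree x3)
    (h12 : Nat.Coprime x1 x2) (h13 : Nat.Coprime x1 x3) (h23 : Nat.Coprime x2 x3)
    (hne : ¬ (x1 = 1 ∧ x2 = 1))
    (s1 : OddSplit x1 t1 D1 E1) (s2 : OddSplit x2 t2 D2 E2) (s3 : OddSplit x3 t3 D3 E3)
    {e1 e2 e3 : ℤ} (hp : TernaryPrimitive e1 e2 e3)
    (he : (x1 : ℤ) * e1 ^ 2 + x2 * e2 ^ 2 = x3 * e3 ^ 2) :
    ∃ y1 y2 y3 : ℤ, ¬ (y1 = 0 ∧ y2 = 0 ∧ y3 = 0) ∧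
      (x1 : ℤ) * y1 ^ 2 + x2 * y2 ^ 2 = x3 * y3 ^ 2 ∧ y3 ^ 2 < 4 * x1 * x2 ∧
      (D1 : ℤ) ∣ y2 * e3 - y3 * e2 ∧ (E1 : ℤ) ∣ y2 * e3 + y3 * e2 ∧
      (D2 : ℤ) ∣ y1 * e3 - y3 * e1 ∧ (E2 : ℤ) ∣ y1 * e3 + y3 * e1 ∧
      (D3 : ℤ) ∣ y1 * e2 - y2 * e1 ∧ (E3 : ℤ) ∣ y1 * e2 + y2 * e1 := by
  have hx1 := Nat.pos_of_ne_zero h1.ne_zero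
  have hx2 := Nat.pos_of_ne_zero h2.ne_zero
  have hx3 := Nat.pos_of_ne_zero h3.ne_zero
  have z1 : Squarefree (x1 : ℤ) := Int.squarefree_natCast.2 h1
  have z2 : Squarefree (x2 : ℤ) := Int.squarefree_natCast.2 h2
  have z3 : Squarefree (-(x3 : ℤ)) := fun d hd =>
    Int.squarefree_natCast.2 h3 d (dvd_neg.1 hd)
  have c12 : IsCoprime (x1 : ℤ) x2 := Nat.isCoprime_iff_coprime.2 h12
  have c13 : IsCoprime (x1 : ℤ) (-x3) := (Nat.isCoprime_iff_coprime.2 h13).neg_right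
  have c23 : IsCoprime (x2 : ℤ) (-x3) := (Nat.isCoprime_iff_coprime.2 h23).neg_right
  have he' : (x1 : ℤ) * e1 ^ 2 + x2 * e2 ^ 2 + (-x3) * e3 ^ 2 = 0 := by linarith
  have podd : ∀ {x t D E : ℕ}, OddSplit x t D E → t = 1 → Odd x := by
    rintro x t D E h rfl
    rw [h.eq, one_mul]; exact h.odd
  have peven : ∀ {x t D E : ℕ}, OddSplit x t D E → t = 2 → Even x := by
    rintro x t D E h rfl
    rw [h.eq]; exact even_two_mul _
  have hnee : ∀ {x y : ℕ}, Nat.Coprime x y → Even x → Even y → False := by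
    intro x y h hx hy
    have := Nat.dvd_gcd hx.two_dvd hy.two_dvd
    rw [h] at this; omega
  have ht : (t1 * t2 * t3 = 1 ∧ Odd (x1 : ℤ) ∧ Odd (x2 : ℤ) ∧ Odd (-(x3 : ℤ))) ∨
      (t1 * t2 * t3 = 2 ∧ (Even (x1 : ℤ) ∨ Even (x2 : ℤ) ∨ Even (-(x3 : ℤ)))) := by
    simp only [even_neg, odd_neg, Int.even_coe_nat, Int.odd_coe_nat]
    rcases s1.two with r1 | r1 <;> rcases s2.two with r2 | r2 <;> rcases s3.two with r3 | r3
    · exact Or.inl ⟨by simp [r1, r2, r3], podd s1 r1, podd s2 r2, podd s3 r3⟩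
    · exact Or.inr ⟨by simp [r1, r2, r3], Or.inr (Or.inr (peven s3 r3))⟩
    · exact Or.inr ⟨by simp [r1, r2, r3], Or.inr (Or.inl (peven s2 r2))⟩
    · exact (hnee h23 (peven s2 r2) (peven s3 r3)).elim
    · exact Or.inr ⟨by simp [r1, r2, r3], Or.inl (peven s1 r1)⟩
    · exact (hnee h13 (peven s1 r1) (peven s3 r3)).elim
    · exact (hnee h12 (peven s1 r1) (peven s2 r2)).elim
    · exact (hnee h12 (peven s1 r1) (peven s2 r2)).elim
  obtain ⟨u1, u2, u3, v1, v2, v3, huv⟩ := exists_two_adic_forms z1 z2 z3 c12 c23 ht he' hp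
  set t := t1 * t2 * t3 with ht_def
  have hprod : 4 * t * (D1 * E1 * (D2 * E2) * (D3 * E3)) = 4 * (x1 * x2 * x3) := by
    rw [s1.eq, s2.eq, s3.eq, ht_def]; ring
  have hprod0 : 4 * t * (D1 * E1 * (D2 * E2) * (D3 * E3)) ≠ 0 := by
    rw [hprod]; positivity
  obtain ⟨y1, y2, y3, hy0, hy1, hy2, hy3, hdvd⟩ := exists_small_of_prod_lt
    ![2 * t, 2, D1, E1, D2, E2, D3, E3]
    (by
      simp only [mul_ne_zero_iff] at hprod0
      intro j
      fin_cases j <;> simp <;> tauto)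
    ![(u1, u2, u3), (v1, v2, v3), (0, e3, -e2), (0, e3, e2), (e3, 0, -e1), (e3, 0, e1),
      (e2, -e1, 0), (e2, e1, 0)] _ _ _
    (by
      refine lt_of_eq_of_lt ?_ (lt_prod_sqrt h1 h2 h3.ne_zero h12 hne)
      rw [← hprod]
      simp [Fin.prod_univ_succ]
      ring)
  simp only [Fin.forall_fin_succ] at hdvd
  simp at hdvd
  obtain ⟨q1, q2, a1, b1, a2, b2, a3, b3⟩ := hdvd
  have bound : ∀ {m : ℕ} {y : ℤ}, 0 < m → |y| < ((Nat.sqrt (m - 1) + 1 : ℕ) : ℤ) →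
      y ^ 2 < m := by
    intro m y hm hy
    have h1 : |y| ≤ Nat.sqrt (m - 1) := by push_cast at hy; omega
    have h2 : (Nat.sqrt (m - 1) : ℤ) ^ 2 ≤ (m - 1 : ℕ) := by exact_mod_cast Nat.sqrt_le' _
    have h3 : y ^ 2 ≤ (Nat.sqrt (m - 1) : ℤ) ^ 2 := by
      rw [← sq_abs]; exact pow_le_pow_left₀ (abs_nonneg _) h1 2
    omega
  have B1 := bound (by positivity) hy1
  have B2 := bound (by positivity) hy2
  have B3 := bound (by positivity) hy3
  push_cast at B1 B2 B3
  set Q := (x1 : ℤ) * y1 ^ 2 + x2 * y2 ^ 2 + (-x3) * y3 ^ 2 with hQ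
  have w1 : (D1 : ℤ) ∣ y2 * e3 - y3 * e2 := by convert a1 using 1; ring
  have w2 : (E1 : ℤ) ∣ y2 * e3 + y3 * e2 := by convert b1 using 1; ring
  have w3 : (D2 : ℤ) ∣ y1 * e3 - y3 * e1 := by convert a2 using 1; ring
  have w4 : (E2 : ℤ) ∣ y1 * e3 + y3 * e1 := by convert b2 using 1; ring
  have w5 : (D3 : ℤ) ∣ y1 * e2 - y2 * e1 := by convert a3 using 1; ring
  have w6 : (E3 : ℤ) ∣ y1 * e2 + y2 * e1 := by convert b3 using 1; ring
  refine ⟨y1, y2, y3, hy0, ?_, B3, w1, w2, w3, w4, w5, w6⟩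
  have dD : ∀ {x t D E : ℕ}, OddSplit x t D E → (D : ℤ) ∣ x := fun h => by
    rw [h.eq]; exact Int.natCast_dvd_natCast.2 ⟨_, mul_left_comm _ _ _⟩
  have dE : ∀ {x t D E : ℕ}, OddSplit x t D E → (E : ℤ) ∣ x := fun {x t D E} h => by
    rw [h.eq]; exact Int.natCast_dvd_natCast.2 ⟨t * D, by ring⟩
  have g1 : IsCoprime (x1 : ℤ) e3 := isCoprime_coeff_of_ternary_zero (y1 := e1) (y2 := e3)
      (y3 := e2) (b := -x3) (c := x2) z1 c12 (by linarith) hp.swap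
  have g2 : IsCoprime (x2 : ℤ) e3 := isCoprime_coeff_of_ternary_zero (y1 := e2) (y2 := e3)
      (y3 := e1) (b := -x3) (c := x1) z2 c12.symm (by linarith) hp.rotate
  have g3 : IsCoprime (-x3 : ℤ) e2 := isCoprime_coeff_of_ternary_zero (y1 := e3) (y2 := e2)
      (y3 := e1) (b := x2) (c := x1) z3 c13.symm (by linarith) hp.rotate.rotate.swap
  have k1 : (D1 : ℤ) ∣ Q := dvd_ternary_of_congr (s := 1) (dD s1)
    (g1.of_isCoprime_of_dvd_left (dD s1)) he' (by norm_num) (by simpa using w1)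
  have k2 : (E1 : ℤ) ∣ Q := dvd_ternary_of_congr (s := -1) (dE s1)
    (g1.of_isCoprime_of_dvd_left (dE s1)) he' (by norm_num) (by simpa using w2)
  have k3 : (D2 : ℤ) ∣ Q := by
    have := dvd_ternary_of_congr (s := 1) (a := x2) (b := x1) (c := -x3) (e1 := e2) (e2 := e1)
      (e3 := e3) (y1 := y2) (y2 := y1) (y3 := y3) (dD s2)
      (g2.of_isCoprime_of_dvd_left (dD s2)) (by linarith) (by norm_num) (by simpa using w3)
    convert this using 1; ring
  have k4 : (E2 : ℤ) ∣ Q := by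
    have := dvd_ternary_of_congr (s := -1) (a := x2) (b := x1) (c := -x3) (e1 := e2) (e2 := e1)
      (e3 := e3) (y1 := y2) (y2 := y1) (y3 := y3) (dE s2)
      (g2.of_isCoprime_of_dvd_left (dE s2)) (by linarith) (by norm_num) (by simpa using w4)
    convert this using 1; ring
  have k5 : (D3 : ℤ) ∣ Q := by
    have := dvd_ternary_of_congr (s := 1) (a := -x3) (b := x1) (c := x2) (e1 := e3) (e2 := e1)
      (e3 := e2) (y1 := y3) (y2 := y1) (y3 := y2) (dD s3).neg_right
      (g3.of_isCoprime_of_dvd_left (dD s3).neg_right) (by linarith) (by norm_num)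
      (by simpa using w5)
    convert this using 1; ring
  have k6 : (E3 : ℤ) ∣ Q := by
    have := dvd_ternary_of_congr (s := -1) (a := -x3) (b := x1) (c := x2) (e1 := e3) (e2 := e1)
      (e3 := e2) (y1 := y3) (y2 := y1) (y3 := y2) (dE s3).neg_right
      (g3.of_isCoprime_of_dvd_left (dE s3).neg_right) (by linarith) (by norm_num)
      (by simpa using w6)
    convert this using 1; ring
  have k7 : ((4 * t : ℕ) : ℤ) ∣ Q := huv y1 y2 y3 (by push_cast; exact q1) q2
  have cDE : ∀ {x t D E : ℕ}, Squarefree x → OddSplit x t D E → Nat.Coprime D E := by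
    intro x t D E hx h
    rw [h.eq] at hx
    exact (Nat.squarefree_mul_iff.1 (hx.squarefree_of_dvd (Dvd.intro_left _ rfl))).1
  have mulDE : ∀ {x t D E : ℕ}, Squarefree x → OddSplit x t D E → (D : ℤ) ∣ Q → (E : ℤ) ∣ Q →
      ((D * E : ℕ) : ℤ) ∣ Q := by
    intro x t D E hx h hD hE
    push_cast
    exact (Nat.isCoprime_iff_coprime.2 (cDE hx h)).mul_dvd hD hE
  have m1 := mulDE h1 s1 k1 k2
  have m2 := mulDE h2 s2 k3 k4
  have m3 := mulDE h3 s3 k5 k6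
  have dDE : ∀ {x t D E : ℕ}, OddSplit x t D E → D * E ∣ x := fun h => by
    rw [h.eq]; exact Dvd.intro_left _ rfl
  have n12 : Nat.Coprime (D1 * E1) (D2 * E2) :=
    h12.coprime_dvd_left (dDE s1) |>.coprime_dvd_right (dDE s2)
  have n13 : Nat.Coprime (D1 * E1) (D3 * E3) :=
    h13.coprime_dvd_left (dDE s1) |>.coprime_dvd_right (dDE s3)
  have n23 : Nat.Coprime (D2 * E2) (D3 * E3) :=
    h23.coprime_dvd_left (dDE s2) |>.coprime_dvd_right (dDE s3)
  have M1 : ((D1 * E1 * (D2 * E2) : ℕ) : ℤ) ∣ Q := by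
    rw [Nat.cast_mul]
    exact (Nat.isCoprime_iff_coprime.2 n12).mul_dvd m1 m2
  have M2 : ((D1 * E1 * (D2 * E2) * (D3 * E3) : ℕ) : ℤ) ∣ Q := by
    rw [Nat.cast_mul]
    exact (Nat.isCoprime_iff_coprime.2 (Nat.Coprime.mul_left n13 n23)).mul_dvd M1 m3
  have n4 : Nat.Coprime (4 * t) (D1 * E1 * (D2 * E2) * (D3 * E3)) := by
    have hodd : Odd (D1 * E1 * (D2 * E2) * (D3 * E3)) := (s1.odd.mul s2.odd).mul s3.odd
    have h4 : Nat.Coprime (2 ^ 3) (D1 * E1 * (D2 * E2) * (D3 * E3)) :=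
      (Nat.coprime_two_left.2 hodd).pow_left 3
    refine h4.coprime_dvd_left ?_
    rcases ht with h | h <;> rw [h.1] <;> norm_num
  have M3 : ((4 * (x1 * x2 * x3) : ℕ) : ℤ) ∣ Q := by
    rw [← hprod, Nat.cast_mul]
    exact (Nat.isCoprime_iff_coprime.2 n4).mul_dvd k7 M2
  have hQ0 : Q = 0 := by
    refine Int.eq_zero_of_abs_lt_dvd M3 ?_
    have := abs_ternary_lt (by exact_mod_cast hx1) (by exact_mod_cast hx2)
      (by exact_mod_cast hx3) B1 B2 B3
    push_cast
    exact this
  linarith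

lemma exists_primitive_part {y1 y2 y3 : ℤ} (h : ¬ (y1 = 0 ∧ y2 = 0 ∧ y3 = 0)) :
    ∃ g z1 z2 z3 : ℤ, g ≠ 0 ∧ y1 = g * z1 ∧ y2 = g * z2 ∧ y3 = g * z3 ∧
      TernaryPrimitive z1 z2 z3 := by
  set g : ℤ := gcd y1 (gcd y2 y3) with hg
  have hg0 : g ≠ 0 := by
    intro h0
    rw [hg, gcd_eq_zero_iff, gcd_eq_zero_iff] at h0
    exact h h0
  obtain ⟨z1, h1⟩ : g ∣ y1 := gcd_dvd_left _ _
  obtain ⟨z2, h2⟩ : g ∣ y2 := (gcd_dvd_right _ _).trans (gcd_dvd_left _ _)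
  obtain ⟨z3, h3⟩ : g ∣ y3 := (gcd_dvd_right _ _).trans (gcd_dvd_right _ _)
  refine ⟨g, z1, z2, z3, hg0, h1, h2, h3, fun d d1 d2 d3 => ?_⟩
  have : g * d ∣ g * 1 := by
    rw [mul_one]
    nth_rewrite 2 [hg]
    refine dvd_gcd ?_ (dvd_gcd ?_ ?_)
    · rw [h1]; exact mul_dvd_mul_left _ d1
    · rw [h2]; exact mul_dvd_mul_left _ d2
    · rw [h3]; exact mul_dvd_mul_left _ d3
  exact isUnit_of_dvd_one (Int.dvd_of_mul_dvd_mul_left hg0 this)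

lemma prime_dvd_iff_of_split {D E p : ℕ} {h y2 y3 e2 e3 : ℤ} (hp : p.Prime) (h2 : p ≠ 2)
    (hDE : p ∣ D * E) (hph : ¬ (p : ℤ) ∣ h) (hD : (D : ℤ) ∣ h * y2 * e3 - h * y3 * e2)
    (hE : (E : ℤ) ∣ h * y2 * e3 + h * y3 * e2) (he : ¬ (p : ℤ) ∣ e3) (hy : ¬ (p : ℤ) ∣ y2) :
    p ∣ D ↔ (p : ℤ) ∣ y2 * e3 - y3 * e2 := by
  have hpz : Prime (p : ℤ) := Nat.prime_iff_prime_int.1 hp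
  constructor
  · intro hd
    have : (p : ℤ) ∣ h * (y2 * e3 - y3 * e2) := by
      rw [mul_sub, ← mul_assoc, ← mul_assoc]
      exact (Int.natCast_dvd_natCast.2 hd).trans hD
    exact (hpz.dvd_or_dvd this).resolve_left hph
  · intro hd
    refine (hp.dvd_mul.1 hDE).resolve_right fun hpE => ?_
    have h1 : (p : ℤ) ∣ h * (y2 * e3 + y3 * e2) := by
      rw [mul_add, ← mul_assoc, ← mul_assoc]
      exact (Int.natCast_dvd_natCast.2 hpE).trans hE
    have h3 := dvd_add hd ((hpz.dvd_or_dvd h1).resolve_left hph)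
    have h4 : (p : ℤ) ∣ 2 * (y2 * e3) := by
      rw [show 2 * (y2 * e3) = y2 * e3 - y3 * e2 + (y2 * e3 + y3 * e2) by ring]; exact h3
    rcases hpz.dvd_or_dvd h4 with h5 | h5
    · have : p ∣ 2 := by exact_mod_cast h5
      exact h2 ((Nat.prime_dvd_prime_iff_eq hp Nat.prime_two).1 this)
    · exact (hpz.dvd_or_dvd h5).elim hy he

lemma eq_one_of_mul_sq_eq {x2 x3 : ℕ} {y2 y3 : ℤ} (h2 : Squarefree x2) (h3 : Squarefree x3)
    (h23 : Nat.Coprime x2 x3) (hp : TernaryPrimitive 0 y2 y3)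
    (h : (x2 : ℤ) * y2 ^ 2 = x3 * y3 ^ 2) : x2 = 1 ∧ x3 = 1 := by
  have hc : IsCoprime y2 y3 := isRelPrime_iff_isCoprime.1 fun d d2 d3 => hp d (dvd_zero _) d2 d3
  have aux : ∀ {x x' : ℕ} {y y' : ℤ}, Squarefree x → Squarefree x' → Nat.Coprime x x' →
      IsCoprime y y' → (x : ℤ) * y ^ 2 = x' * y' ^ 2 → x = 1 := by
    intro x x' y y' hx hx' hxx hyy heq
    have hu : IsUnit y' := by
      refine Int.squarefree_natCast.2 hx y' ?_
      rw [← sq]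
      exact (hyy.symm.pow (m := 2) (n := 2)).dvd_of_dvd_mul_right ⟨x', by rw [heq]; ring⟩
    have hd : (x : ℤ) ∣ x' := by
      refine ⟨y ^ 2, ?_⟩
      rw [heq, Int.isUnit_sq hu, mul_one]
    exact Nat.eq_one_of_dvd_coprimes hxx dvd_rfl (Int.natCast_dvd_natCast.1 hd)
  exact ⟨aux h2 h3 h23 hc h, aux h3 h2 h23.symm hc.symm h.symm⟩

/-- `u = (((c1, b1), (c2, b2), (c3, b3)), (y1, y2, y3))` records a primitive zero of the form with
coefficients `x1, x2, -x3`, together with factors `ci * bi` of the coefficients whose product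
tightens the bound on `y3`. -/
structure SmallZero (x1 x2 x3 : ℕ) (u : ((ℕ × ℕ) × (ℕ × ℕ) × (ℕ × ℕ)) × (ℤ × ℤ × ℤ)) : Prop where
  dvd1 : u.1.1.1 * u.1.1.2 ∣ x1
  dvd2 : u.1.2.1.1 * u.1.2.1.2 ∣ x2
  dvd3 : u.1.2.2.1 * u.1.2.2.2 ∣ x3
  prim : TernaryPrimitive u.2.1 u.2.2.1 u.2.2.2
  zero : (x1 : ℤ) * u.2.1 ^ 2 + x2 * u.2.2.1 ^ 2 = x3 * u.2.2.2 ^ 2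
  bound : (u.1.1.1 * u.1.1.2 * (u.1.2.1.1 * u.1.2.1.2) * (u.1.2.2.1 * u.1.2.2.2) : ℤ) ^ 2 *
    u.2.2.2 ^ 2 < 4 * x1 * x2
  pos : 0 < u.2.2.2
  ne1 : u.2.1 ≠ 0
  ne2 : u.2.2.1 ≠ 0

theorem exists_smallZero_of_split {x1 x2 x3 t1 t2 t3 D1 E1 D2 E2 D3 E3 : ℕ}
    (h1 : Squarefree x1) (h2 : Squarefree x2) (h3 : Squarefree x3)
    (h12 : Nat.Coprime x1 x2) (h13 : Nat.Coprime x1 x3) (h23 : Nat.Coprime x2 x3)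
    (hne12 : ¬ (x1 = 1 ∧ x2 = 1)) (hne13 : ¬ (x1 = 1 ∧ x3 = 1)) (hne23 : ¬ (x2 = 1 ∧ x3 = 1))
    (s1 : OddSplit x1 t1 D1 E1) (s2 : OddSplit x2 t2 D2 E2) (s3 : OddSplit x3 t3 D3 E3)
    {e1 e2 e3 : ℤ} (hp : TernaryPrimitive e1 e2 e3)
    (he : (x1 : ℤ) * e1 ^ 2 + x2 * e2 ^ 2 = x3 * e3 ^ 2) :
    ∃ u, SmallZero x1 x2 x3 u ∧ u.1.1.1 = Nat.gcd D1 (u.1.1.1 * u.1.1.2) ∧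
      u.1.2.1.1 = Nat.gcd D2 (u.1.2.1.1 * u.1.2.1.2) ∧
      u.1.2.2.1 = Nat.gcd D3 (u.1.2.2.1 * u.1.2.2.2) ∧
      (∀ p : ℕ, p.Prime → p ∣ D1 * E1 → ¬ p ∣ u.1.1.1 * u.1.1.2 →
        (p ∣ D1 ↔ (p : ℤ) ∣ u.2.2.1 * e3 - u.2.2.2 * e2)) ∧
      (∀ p : ℕ, p.Prime → p ∣ D2 * E2 → ¬ p ∣ u.1.2.1.1 * u.1.2.1.2 →
        (p ∣ D2 ↔ (p : ℤ) ∣ u.2.1 * e3 - u.2.2.2 * e1)) ∧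
      (∀ p : ℕ, p.Prime → p ∣ D3 * E3 → ¬ p ∣ u.1.2.2.1 * u.1.2.2.2 →
        (p ∣ D3 ↔ (p : ℤ) ∣ u.2.1 * e2 - u.2.2.1 * e1)) := by
  obtain ⟨y1, y2, y3, hy0, hQ, hB, w1, w2, w3, w4, w5, w6⟩ :=
    exists_ternary_zero_of_split h1 h2 h3 h12 h13 h23 hne12 s1 s2 s3 hp he
  have p1 : (0 : ℤ) < x1 := by exact_mod_cast Nat.pos_of_ne_zero h1.ne_zero
  have p2 : (0 : ℤ) < x2 := by exact_mod_cast Nat.pos_of_ne_zero h2.ne_zero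
  have p3 : (0 : ℤ) < x3 := by exact_mod_cast Nat.pos_of_ne_zero h3.ne_zero
  have hy3 : y3 ≠ 0 := by
    rintro rfl
    have q1 : 0 ≤ (x1 : ℤ) * y1 ^ 2 := by positivity
    have q2 : 0 ≤ (x2 : ℤ) * y2 ^ 2 := by positivity
    have r1 : (x1 : ℤ) * y1 ^ 2 = 0 := by linarith
    have r2 : (x2 : ℤ) * y2 ^ 2 = 0 := by linarith
    exact hy0 ⟨pow_eq_zero_iff two_ne_zero |>.1 ((mul_eq_zero.1 r1).resolve_left p1.ne'),
      pow_eq_zero_iff two_ne_zero |>.1 ((mul_eq_zero.1 r2).resolve_left p2.ne'), rfl⟩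
  obtain ⟨h, z1, z2, z3, hh, e_1, e_2, e_3, hz, hz3⟩ : ∃ h z1 z2 z3 : ℤ, h ≠ 0 ∧ y1 = h * z1 ∧
      y2 = h * z2 ∧ y3 = h * z3 ∧ TernaryPrimitive z1 z2 z3 ∧ 0 < z3 := by
    obtain ⟨g, z1, z2, z3, hg, q1, q2, q3, hz⟩ := exists_primitive_part hy0
    rcases lt_trichotomy z3 0 with hlt | heq | hgt
    · refine ⟨-g, -z1, -z2, -z3, neg_ne_zero.2 hg, by linarith, by linarith, by linarith,
        fun d d1 d2 d3 => hz d ((dvd_neg).1 d1) ((dvd_neg).1 d2) ((dvd_neg).1 d3), by linarith⟩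
    · exact (hy3 (by rw [q3, heq, mul_zero])).elim
    · exact ⟨g, z1, z2, z3, hg, q1, q2, q3, hz, hgt⟩
  subst e_1 e_2 e_3
  have hQz : (x1 : ℤ) * z1 ^ 2 + x2 * z2 ^ 2 = x3 * z3 ^ 2 := by
    have : h ^ 2 * (x1 * z1 ^ 2 + x2 * z2 ^ 2) = h ^ 2 * (x3 * z3 ^ 2) := by linarith
    exact mul_left_cancel₀ (pow_ne_zero 2 hh) this
  set k1 := Nat.gcd h.natAbs x1 with hk1
  set k2 := Nat.gcd h.natAbs x2 with hk2
  set k3 := Nat.gcd h.natAbs x3 with hk3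
  have f : ∀ D k : ℕ, Nat.gcd D k * (k / Nat.gcd D k) = k :=
    fun D k => Nat.mul_div_cancel' (Nat.gcd_dvd_right _ _)
  have hkk : k1 * k2 * k3 ∣ h.natAbs := by
    have d1 : k1 ∣ x1 := Nat.gcd_dvd_right _ _
    have d2 : k2 ∣ x2 := Nat.gcd_dvd_right _ _
    have d3 : k3 ∣ x3 := Nat.gcd_dvd_right _ _
    have c12 : Nat.Coprime k1 k2 := (h12.coprime_dvd_left d1).coprime_dvd_right d2
    have c13 : Nat.Coprime k1 k3 := (h13.coprime_dvd_left d1).coprime_dvd_right d3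
    have c23 : Nat.Coprime k2 k3 := (h23.coprime_dvd_left d2).coprime_dvd_right d3
    exact (Nat.Coprime.mul_left c13 c23).mul_dvd_of_dvd_of_dvd
      (c12.mul_dvd_of_dvd_of_dvd (Nat.gcd_dvd_left _ _) (Nat.gcd_dvd_left _ _))
      (Nat.gcd_dvd_left _ _)
  have key : ∀ {x t D E p : ℕ} {a b a' b' : ℤ}, OddSplit x t D E → p.Prime → p ∣ D * E →
      ¬ p ∣ Nat.gcd h.natAbs x → IsCoprime (x : ℤ) b' → IsCoprime (x : ℤ) a →
      (D : ℤ) ∣ h * a * b' - h * b * a' → (E : ℤ) ∣ h * a * b' + h * b * a' →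
      (p ∣ D ↔ (p : ℤ) ∣ a * b' - b * a') := by
    intro x t D E p a b a' b' s hpp hpd hpk cb ca hD hE
    have hpx : p ∣ x := by rw [s.eq]; exact hpd.mul_left _
    have hpxz : (p : ℤ) ∣ x := Int.natCast_dvd_natCast.2 hpx
    have hpz : Prime (p : ℤ) := Nat.prime_iff_prime_int.1 hpp
    refine prime_dvd_iff_of_split hpp ?_ hpd (fun hd => hpk ?_) hD hE
      (fun hd => hpz.not_isUnit (cb.isUnit_of_dvd' hpxz hd))
      (fun hd => hpz.not_isUnit (ca.isUnit_of_dvd' hpxz hd))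
    · rintro rfl
      exact Nat.not_even_iff_odd.2 s.odd (even_iff_two_dvd.2 hpd)
    · exact Nat.dvd_gcd (Int.natCast_dvd.1 hd) hpx
  have z1' : Squarefree (x1 : ℤ) := Int.squarefree_natCast.2 h1
  have z2' : Squarefree (x2 : ℤ) := Int.squarefree_natCast.2 h2
  have z3' : Squarefree (x3 : ℤ) := Int.squarefree_natCast.2 h3
  have c12 : IsCoprime (x1 : ℤ) x2 := Nat.isCoprime_iff_coprime.2 h12
  have c13 : IsCoprime (x1 : ℤ) x3 := Nat.isCoprime_iff_coprime.2 h13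
  have coe1 : ∀ {a b c : ℤ}, TernaryPrimitive a b c →
      (x1 : ℤ) * a ^ 2 + x2 * b ^ 2 = x3 * c ^ 2 → IsCoprime (x1 : ℤ) b ∧ IsCoprime (x1 : ℤ) c ∧
      IsCoprime (x2 : ℤ) a ∧ IsCoprime (x2 : ℤ) c ∧
      IsCoprime (x3 : ℤ) a ∧ IsCoprime (x3 : ℤ) b := by
    intro a b c hp he
    refine ⟨?_, ?_, ?_, ?_, ?_, ?_⟩
    · exact isCoprime_coeff_of_ternary_zero (y1 := a) (y2 := b) (y3 := c) (b := x2) (c := -x3) z1'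
        c13.neg_right (by linarith) hp
    · exact isCoprime_coeff_of_ternary_zero (y1 := a) (y2 := c) (y3 := b) (b := -x3) (c := x2) z1'
        c12 (by linarith) hp.swap
    · exact isCoprime_coeff_of_ternary_zero (y1 := b) (y2 := a) (y3 := c) (b := x1) (c := -x3) z2'
        (Nat.isCoprime_iff_coprime.2 h23).neg_right (by linarith) hp.rotate.swap
    · exact isCoprime_coeff_of_ternary_zero (y1 := b) (y2 := c) (y3 := a) (b := -x3) (c := x1) z2'
        c12.symm (by linarith) hp.rotate
    · exact isCoprime_coeff_of_ternary_zero (y1 := c) (y2 := a) (y3 := b) (b := -x1) (c := -x2) z3'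
        (Nat.isCoprime_iff_coprime.2 h23).symm.neg_right (by linarith) hp.rotate.rotate
    · exact isCoprime_coeff_of_ternary_zero (y1 := c) (y2 := b) (y3 := a) (b := -x2) (c := -x1) z3'
        c13.symm.neg_right (by linarith) hp.rotate.rotate.swap
  obtain ⟨a1, a2, a3, a4, a5, a6⟩ := coe1 hp he
  obtain ⟨b1, b2, b3, b4, b5, b6⟩ := coe1 hz hQz
  refine ⟨(((Nat.gcd D1 k1, k1 / Nat.gcd D1 k1), (Nat.gcd D2 k2, k2 / Nat.gcd D2 k2),
    (Nat.gcd D3 k3, k3 / Nat.gcd D3 k3)), (z1, z2, z3)),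
    ⟨?_, ?_, ?_, hz, hQz, ?_, hz3, ?_, ?_⟩, ?_, ?_, ?_, fun p pp pd pk => ?_,
    fun p pp pd pk => ?_, fun p pp pd pk => ?_⟩
  · rw [f]; exact Nat.gcd_dvd_right _ _
  · rw [f]; exact Nat.gcd_dvd_right _ _
  · rw [f]; exact Nat.gcd_dvd_right _ _
  · refine lt_of_le_of_lt ?_ hB
    simp only [← Nat.cast_mul]
    rw [f, f, f, mul_pow]
    refine mul_le_mul_of_nonneg_right ?_ (sq_nonneg _)
    rw [← Int.natAbs_sq h]
    exact_mod_cast Nat.pow_le_pow_left (Nat.le_of_dvd (Int.natAbs_pos.2 hh) hkk) 2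
  · rintro rfl
    exact hne23 (eq_one_of_mul_sq_eq h2 h3 h23 hz (by linarith))
  · rintro rfl
    exact hne13 (eq_one_of_mul_sq_eq h1 h3 h13 hz.rotate.swap (by linarith))
  · rw [f]
  · rw [f]
  · rw [f]
  · rw [f] at pk
    exact key s1 pp pd pk a2 b1 w1 w2
  · rw [f] at pk
    exact key s2 pp pd pk a4 b3 w3 w4
  · rw [f] at pk
    exact key s3 pp pd pk a6 b5 w5 w6

lemma exists_odd_part {x : ℕ} (hx : Squarefree x) :
    ∃ t o : ℕ, x = t * o ∧ Odd o ∧ (t = 1 ∨ t = 2) ∧ Nat.Coprime t o := by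
  rcases Nat.even_or_odd x with h | h
  · obtain ⟨o, rfl⟩ := h.two_dvd
    have hc := (Nat.squarefree_mul_iff.1 hx).1
    exact ⟨2, o, rfl, Nat.coprime_two_left.1 hc, Or.inr rfl, hc⟩
  · exact ⟨1, x, by simp, h, Or.inl rfl, by simp⟩

lemma eq_of_gcd_eq_of_prime_dvd_iff {x D D' k : ℕ} {P : ℕ → Prop} (hx : Squarefree x) (hD : D ∣ x)
    (hD' : D' ∣ x) (hg : Nat.gcd D k = Nat.gcd D' k)
    (h : ∀ p : ℕ, p.Prime → p ∣ x → ¬ p ∣ k → (p ∣ D ↔ P p))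
    (h' : ∀ p : ℕ, p.Prime → p ∣ x → ¬ p ∣ k → (p ∣ D' ↔ P p)) : D = D' := by
  rw [Nat.Squarefree.ext_iff (hx.squarefree_of_dvd hD) (hx.squarefree_of_dvd hD')]
  intro p hp
  by_cases hpk : p ∣ k
  · have e : ∀ d : ℕ, p ∣ d ↔ p ∣ Nat.gcd d k := fun d => by simp [Nat.dvd_gcd_iff, hpk]
    rw [e D, e D', hg]
  by_cases hpx : p ∣ x
  · rw [h p hp hpx hpk, h' p hp hpx hpk]
  · exact ⟨fun hd => (hpx (hd.trans hD)).elim, fun hd => (hpx (hd.trans hD')).elim⟩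

theorem card_divisors_le_two_mul_card {x1 x2 x3 : ℕ}
    (h1 : Squarefree x1) (h2 : Squarefree x2) (h3 : Squarefree x3)
    (h12 : Nat.Coprime x1 x2) (h13 : Nat.Coprime x1 x3) (h23 : Nat.Coprime x2 x3)
    (hne12 : ¬ (x1 = 1 ∧ x2 = 1)) (hne13 : ¬ (x1 = 1 ∧ x3 = 1)) (hne23 : ¬ (x2 = 1 ∧ x3 = 1))
    (hsol : ∃ y1 y2 y3 : ℤ, (y1, y2, y3) ≠ (0, 0, 0) ∧
      (x1 : ℤ) * y1 ^ 2 + x2 * y2 ^ 2 = x3 * y3 ^ 2)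
    (U : Finset (((ℕ × ℕ) × (ℕ × ℕ) × (ℕ × ℕ)) × (ℤ × ℤ × ℤ)))
    (hU : ∀ u, SmallZero x1 x2 x3 u → u ∈ U) :
    (x1 * x2 * x3).divisors.card ≤ 2 * U.card := by
  obtain ⟨y1, y2, y3, hy0, hy⟩ := hsol
  obtain ⟨g, e1, e2, e3, hg, rfl, rfl, rfl, hp⟩ := exists_primitive_part
    (y1 := y1) (y2 := y2) (y3 := y3) (by simpa using hy0)
  have he : (x1 : ℤ) * e1 ^ 2 + x2 * e2 ^ 2 = x3 * e3 ^ 2 := by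
    have : g ^ 2 * (x1 * e1 ^ 2 + x2 * e2 ^ 2) = g ^ 2 * (x3 * e3 ^ 2) := by linarith
    exact mul_left_cancel₀ (pow_ne_zero 2 hg) this
  obtain ⟨t1, o1, q1, odd1, r1, c1⟩ := exists_odd_part h1
  obtain ⟨t2, o2, q2, odd2, r2, c2⟩ := exists_odd_part h2
  obtain ⟨t3, o3, q3, odd3, r3, c3⟩ := exists_odd_part h3
  have split : ∀ {x t o D : ℕ}, x = t * o → Odd o → (t = 1 ∨ t = 2) → D ∣ o →
      OddSplit x t D (o / D) := by
    intro x t o D hx ho ht hD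
    have := Nat.mul_div_cancel' hD
    exact ⟨by rw [this, hx], by rwa [this], ht⟩
  have hex : ∀ D : ℕ × ℕ × ℕ, D ∈ o1.divisors ×ˢ o2.divisors ×ˢ o3.divisors → _ := fun D hD => by
    simp only [Finset.mem_product, Nat.mem_divisors] at hD
    exact exists_smallZero_of_split h1 h2 h3 h12 h13 h23 hne12 hne13 hne23
      (split q1 odd1 r1 hD.1.1) (split q2 odd2 r2 hD.2.1.1) (split q3 odd3 r3 hD.2.2.1) hp he
  choose! F hF using hex
  have hcard : (o1.divisors ×ˢ o2.divisors ×ˢ o3.divisors).card ≤ U.card := by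
    refine Finset.card_le_card_of_injOn F (fun D hD => hU _ (hF D hD).1) ?_
    intro D hD D' hD' hFF
    obtain ⟨-, a1, a2, a3, a4, a5, a6⟩ := hF D hD
    obtain ⟨-, b1, b2, b3, b4, b5, b6⟩ := hF D' hD'
    rw [← hFF] at b1 b2 b3 b4 b5 b6
    simp only [Finset.coe_product, Set.mem_prod, Finset.mem_coe, Nat.mem_divisors] at hD hD'
    rw [Nat.mul_div_cancel' hD.1.1] at a4
    rw [Nat.mul_div_cancel' hD.2.1.1] at a5
    rw [Nat.mul_div_cancel' hD.2.2.1] at a6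
    rw [Nat.mul_div_cancel' hD'.1.1] at b4
    rw [Nat.mul_div_cancel' hD'.2.1.1] at b5
    rw [Nat.mul_div_cancel' hD'.2.2.1] at b6
    have sq : ∀ {x t o : ℕ}, Squarefree x → x = t * o → Squarefree o := fun hx h =>
      hx.squarefree_of_dvd ⟨_, h.trans (mul_comm _ _)⟩
    refine Prod.ext ?_ (Prod.ext ?_ ?_)
    · exact eq_of_gcd_eq_of_prime_dvd_iff (sq h1 q1) hD.1.1 hD'.1.1 (a1.symm.trans b1) a4 b4
    · exact eq_of_gcd_eq_of_prime_dvd_iff (sq h2 q2) hD.2.1.1 hD'.2.1.1 (a2.symm.trans b2) a5 b5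
    · exact eq_of_gcd_eq_of_prime_dvd_iff (sq h3 q3) hD.2.2.1 hD'.2.2.1 (a3.symm.trans b3) a6 b6
  have hmul : (x1 * x2 * x3).divisors.card =
      t1.divisors.card * t2.divisors.card * t3.divisors.card *
        (o1.divisors ×ˢ o2.divisors ×ˢ o3.divisors).card := by
    rw [(Nat.Coprime.mul_left h13 h23).card_divisors_mul, h12.card_divisors_mul, q1, q2, q3,
      c1.card_divisors_mul, c2.card_divisors_mul, c3.card_divisors_mul]
    simp only [Finset.card_product]
    ring
  have ht : t1.divisors.card * t2.divisors.card * t3.divisors.card ≤ 2 := by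
    have hne : ∀ {x y a b : ℕ}, Nat.Coprime x y → x = 2 * a → y = 2 * b → False := by
      rintro x y a b h rfl rfl
      have := Nat.dvd_gcd (Dvd.intro a rfl : 2 ∣ 2 * a) (Dvd.intro b rfl : 2 ∣ 2 * b)
      rw [h] at this; omega
    have d2 : (Nat.divisors 2).card = 2 := by decide
    rcases r1 with rfl | rfl <;> rcases r2 with rfl | rfl <;> rcases r3 with rfl | rfl <;>
      first
      | exact (hne h12 q1 q2).elim
      | exact (hne h13 q1 q3).elim
      | exact (hne h23 q2 q3).elim
      | simp [d2]
  rw [hmul]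
  exact Nat.mul_le_mul ht hcard

lemma card_le_of_spaced {α : Type*} (S : Finset α) (ρ : α → ℝ) {L δ : ℝ} (hδ : 0 < δ)
    (hL : 0 ≤ L) (hρ : ∀ s ∈ S, 0 ≤ ρ s ∧ ρ s ≤ L)
    (hsp : ∀ s ∈ S, ∀ t ∈ S, s ≠ t → δ ≤ |ρ s - ρ t|) : (S.card : ℝ) ≤ 1 + L / δ := by
  have hcard : S.card ≤ (Finset.range (⌊L / δ⌋₊ + 1)).card := by
    refine Finset.card_le_card_of_injOn (fun s => ⌊ρ s / δ⌋₊) (fun s hs => ?_) ?_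
    · simp only [Finset.coe_range, Set.mem_Iio, Nat.lt_succ_iff]
      exact Nat.floor_le_floor (div_le_div_of_nonneg_right (hρ s hs).2 hδ.le)
    · intro s hs t ht hst
      by_contra hne
      have h1 := hsp s hs t ht hne
      have hst' : ⌊ρ s / δ⌋₊ = ⌊ρ t / δ⌋₊ := hst
      have a1 := Nat.floor_le (div_nonneg (hρ s hs).1 hδ.le)
      have a2 := Nat.lt_floor_add_one (ρ s / δ)
      have b1 := Nat.floor_le (div_nonneg (hρ t ht).1 hδ.le)
      have b2 := Nat.lt_floor_add_one (ρ t / δ)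
      rw [hst'] at a1 a2
      have : |ρ s / δ - ρ t / δ| < 1 := by rw [abs_lt]; constructor <;> linarith
      rw [← sub_div, abs_div, abs_of_pos hδ, div_lt_one hδ] at this
      linarith
  rw [Finset.card_range] at hcard
  have : (S.card : ℝ) ≤ ⌊L / δ⌋₊ + 1 := by exact_mod_cast hcard
  have := Nat.floor_le (div_nonneg hL hδ.le)
  linarith

/-- The admissible coefficient triples for `x1 * y1 ^ 2 + x2 * y2 ^ 2 - x3 * y3 ^ 2`. -/
structure CoprimeTriple (x : ℕ × ℕ × ℕ) : Prop where
  sq1 : Squarefree x.1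
  sq2 : Squarefree x.2.1
  sq3 : Squarefree x.2.2
  co12 : Nat.Coprime x.1 x.2.1
  co13 : Nat.Coprime x.1 x.2.2
  co23 : Nat.Coprime x.2.1 x.2.2

/-- The product of the recorded factors of the coefficients. -/
def factorProd (c : (ℕ × ℕ) × (ℕ × ℕ) × (ℕ × ℕ)) : ℕ :=
  c.1.1 * c.1.2 * (c.2.1.1 * c.2.1.2) * (c.2.2.1 * c.2.2.2)

lemma factorProd_mul_sq_dvd {x x' : ℕ × ℕ × ℕ} (hx : CoprimeTriple x)
    {u : ((ℕ × ℕ) × (ℕ × ℕ) × (ℕ × ℕ)) × (ℤ × ℤ × ℤ)}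
    (hu : SmallZero x.1 x.2.1 x.2.2 u) (hu' : SmallZero x'.1 x'.2.1 x'.2.2 u) :
    (factorProd u.1 : ℤ) * u.2.2.2 ^ 2 ∣ (x.1 : ℤ) * x'.2.1 - x'.1 * x.2.1 := by
  obtain ⟨x1, x2, x3⟩ := x
  obtain ⟨x1', x2', x3'⟩ := x'
  obtain ⟨⟨⟨c1, b1⟩, ⟨c2, b2⟩, c3, b3⟩, y1, y2, y3⟩ := u
  obtain ⟨d1, d2, d3, hp, hz, -, -, -, -⟩ := hu
  obtain ⟨d1', d2', d3', -, hz', -, -, -, -⟩ := hu'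
  obtain ⟨h1, h2, h3, h12, h13, h23⟩ := hx
  simp only at *
  have z1 : Squarefree (x1 : ℤ) := Int.squarefree_natCast.2 h1
  have z2 : Squarefree (x2 : ℤ) := Int.squarefree_natCast.2 h2
  have z3 : Squarefree (x3 : ℤ) := Int.squarefree_natCast.2 h3
  have y13 : IsCoprime y1 y3 := isCoprime_of_ternary_zero (a := x2) (b := x1) (c := -x3) z2
    (by linarith) hp.rotate.swap
  have g13 : IsCoprime (x1 : ℤ) y3 := isCoprime_coeff_of_ternary_zero (y1 := y1) (y2 := y3)
    (y3 := y2) (b := -x3) (c := x2) z1 (Nat.isCoprime_iff_coprime.2 h12) (by linarith) hp.swap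
  have g23 : IsCoprime (x2 : ℤ) y3 := isCoprime_coeff_of_ternary_zero (y1 := y2) (y2 := y3)
    (y3 := y1) (b := -x3) (c := x1) z2 (Nat.isCoprime_iff_coprime.2 h12).symm (by linarith)
    hp.rotate
  have g31 : IsCoprime (x3 : ℤ) y1 := isCoprime_coeff_of_ternary_zero (y1 := y3) (y2 := y1)
    (y3 := y2) (b := -x1) (c := -x2) z3 (Nat.isCoprime_iff_coprime.2 h23).symm.neg_right
    (by linarith) hp.rotate.rotate
  set k1 := c1 * b1 with hk1
  set k2 := c2 * b2 with hk2
  set k3 := c3 * b3 with hk3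
  have e1 := Int.natCast_dvd_natCast.2 d1
  have e2 := Int.natCast_dvd_natCast.2 d2
  have e3 := Int.natCast_dvd_natCast.2 d3
  have e1' := Int.natCast_dvd_natCast.2 d1'
  have e2' := Int.natCast_dvd_natCast.2 d2'
  have e3' := Int.natCast_dvd_natCast.2 d3'
  have q1 : (k1 : ℤ) ∣ (x1 : ℤ) * x2' - x1' * x2 := dvd_sub (e1.mul_right _) (e1'.mul_right _)
  have q2 : (k2 : ℤ) ∣ (x1 : ℤ) * x2' - x1' * x2 := dvd_sub (e2'.mul_left _) (e2.mul_left _)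
  have q3 : (k3 : ℤ) * y3 ^ 2 ∣ (x1 : ℤ) * x2' - x1' * x2 := by
    have hco : IsCoprime ((k3 : ℤ) * y3 ^ 2) (y1 ^ 2) :=
      IsCoprime.mul_left (g31.of_isCoprime_of_dvd_left e3).pow_right y13.symm.pow
    refine hco.dvd_of_dvd_mul_right ?_
    have : ((x1 : ℤ) * x2' - x1' * x2) * y1 ^ 2 = (x2' * x3 - x2 * x3') * y3 ^ 2 := by
      linear_combination (x2' : ℤ) * hz - (x2 : ℤ) * hz'
    rw [this]
    exact mul_dvd_mul_right (dvd_sub (e3.mul_left _) (e3'.mul_left _)) _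
  have c12 : IsCoprime (k1 : ℤ) k2 := Nat.isCoprime_iff_coprime.2
    ((h12.coprime_dvd_left d1).coprime_dvd_right d2)
  have c13 : IsCoprime (k1 : ℤ) k3 := Nat.isCoprime_iff_coprime.2
    ((h13.coprime_dvd_left d1).coprime_dvd_right d3)
  have c23 : IsCoprime (k2 : ℤ) k3 := Nat.isCoprime_iff_coprime.2
    ((h23.coprime_dvd_left d2).coprime_dvd_right d3)
  have := (IsCoprime.mul_left
    (c13.mul_right ((g13.of_isCoprime_of_dvd_left e1).pow_right (n := 2)))
    (c23.mul_right ((g23.of_isCoprime_of_dvd_left e2).pow_right (n := 2)))).mul_dvd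
    (c12.mul_dvd q1 q2) q3
  simp only [factorProd]
  rw [← hk1, ← hk2, ← hk3]
  push_cast at this ⊢
  rwa [mul_assoc ((k1 : ℤ) * k2)]

lemma eq_of_cross_eq {x x' : ℕ × ℕ × ℕ} (hx : CoprimeTriple x) (hx' : CoprimeTriple x')
    {u : ((ℕ × ℕ) × (ℕ × ℕ) × (ℕ × ℕ)) × (ℤ × ℤ × ℤ)}
    (hu : SmallZero x.1 x.2.1 x.2.2 u) (hu' : SmallZero x'.1 x'.2.1 x'.2.2 u)
    (h : x.1 * x'.2.1 = x'.1 * x.2.1) : x = x' := by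
  have d1 : x.1 = x'.1 := Nat.dvd_antisymm
    (hx.co12.dvd_of_dvd_mul_right (Dvd.intro _ h))
    (hx'.co12.dvd_of_dvd_mul_right (Dvd.intro _ h.symm))
  have d2 : x.2.1 = x'.2.1 := by
    rw [d1] at h
    exact (Nat.eq_of_mul_eq_mul_left (Nat.pos_of_ne_zero hx'.sq1.ne_zero) h).symm
  have h1 := hu.zero
  have h2 := hu'.zero
  rw [d1, d2, h2] at h1
  have h3 : ((x'.2.2 : ℕ) : ℤ) = x.2.2 :=
    mul_right_cancel₀ (pow_ne_zero 2 hu.pos.ne') h1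
  exact Prod.ext d1 (Prod.ext d2 (by exact_mod_cast h3.symm))

lemma SmallZero.one_le_factorProd {x : ℕ × ℕ × ℕ} (hx : CoprimeTriple x)
    {u : ((ℕ × ℕ) × (ℕ × ℕ) × (ℕ × ℕ)) × (ℤ × ℤ × ℤ)}
    (hu : SmallZero x.1 x.2.1 x.2.2 u) : 1 ≤ factorProd u.1 := by
  have h1 := Nat.pos_of_dvd_of_pos hu.dvd1 (Nat.pos_of_ne_zero hx.sq1.ne_zero)
  have h2 := Nat.pos_of_dvd_of_pos hu.dvd2 (Nat.pos_of_ne_zero hx.sq2.ne_zero)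
  have h3 := Nat.pos_of_dvd_of_pos hu.dvd3 (Nat.pos_of_ne_zero hx.sq3.ne_zero)
  exact Nat.mul_pos (Nat.mul_pos h1 h2) h3

lemma SmallZero.factorProd_mul_sq_lt {x : ℕ × ℕ × ℕ} {X1 X2 : ℕ}
    (h1 : x.1 < 2 * X1) (h2 : x.2.1 < 2 * X2)
    {u : ((ℕ × ℕ) × (ℕ × ℕ) × (ℕ × ℕ)) × (ℤ × ℤ × ℤ)}
    (hu : SmallZero x.1 x.2.1 x.2.2 u) :
    ((factorProd u.1 : ℝ) * u.2.2.2) ^ 2 < 16 * (X1 * X2) := by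
  have h := hu.bound
  have h' : ((factorProd u.1 : ℝ) * u.2.2.2) ^ 2 < 4 * x.1 * x.2.1 := by
    rw [mul_pow]
    simp only [factorProd]
    exact_mod_cast h
  have h3 : (x.1 : ℝ) ≤ 2 * X1 := by exact_mod_cast h1.le
  have h4 : (x.2.1 : ℝ) ≤ 2 * X2 := by exact_mod_cast h2.le
  have h5 : (x.1 : ℝ) * x.2.1 ≤ (2 * X1) * (2 * X2) := by gcongr
  linarith

theorem card_triples_le {X1 X2 : ℕ} (S : Finset (ℕ × ℕ × ℕ))
    (u : ((ℕ × ℕ) × (ℕ × ℕ) × (ℕ × ℕ)) × (ℤ × ℤ × ℤ))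
    (hS : ∀ x ∈ S, CoprimeTriple x ∧ SmallZero x.1 x.2.1 x.2.2 u ∧
      (X1 ≤ x.1 ∧ x.1 < 2 * X1) ∧ X2 ≤ x.2.1 ∧ x.2.1 < 2 * X2) :
    (S.card : ℝ) ≤ 24 * (X1 * X2) / (factorProd u.1 * (u.2.2.2 : ℝ) ^ 2) := by
  rcases S.eq_empty_or_nonempty with rfl | ⟨x0, hx0⟩
  · simp only [Finset.card_empty, Nat.cast_zero]; positivity
  obtain ⟨ht0, hu0, ⟨-, l1⟩, -, l2⟩ := hS x0 hx0
  have pX1 : (0 : ℝ) < X1 := by exact_mod_cast (by omega : 0 < X1)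
  have pX2 : (0 : ℝ) < X2 := by exact_mod_cast (by omega : 0 < X2)
  have hk : (1 : ℝ) ≤ factorProd u.1 := by exact_mod_cast hu0.one_le_factorProd ht0
  have hy : (0 : ℝ) < u.2.2.2 := by exact_mod_cast hu0.pos
  have hb := hu0.factorProd_mul_sq_lt l1 l2
  set k : ℝ := ((factorProd u.1 : ℕ) : ℝ) with hk_def
  set y : ℝ := ((u.2.2.2 : ℤ) : ℝ) with hy_def
  have hδ : 0 < k * y ^ 2 / (4 * X2 ^ 2) := by positivity
  have main := card_le_of_spaced S (fun x => (x.1 : ℝ) / x.2.1) (L := 2 * X1 / X2) hδ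
    (by positivity) (fun x hx => ⟨by positivity, ?_⟩) (fun x hx x' hx' hne => ?_)
  · have e : 2 * (X1 : ℝ) / X2 / (k * y ^ 2 / (4 * X2 ^ 2)) = 8 * (X1 * X2) / (k * y ^ 2) := by
      field_simp; ring
    rw [e] at main
    have h1 : 1 ≤ 16 * (X1 * X2) / (k * y ^ 2) := by
      rw [le_div_iff₀ (by positivity)]
      have : k * y ^ 2 ≤ (k * y) ^ 2 := by
        rw [mul_pow]; gcongr; nlinarith
      linarith
    calc (S.card : ℝ) ≤ 1 + 8 * (X1 * X2) / (k * y ^ 2) := main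
      _ ≤ 16 * (X1 * X2) / (k * y ^ 2) + 8 * (X1 * X2) / (k * y ^ 2) := by linarith
      _ = _ := by ring
  · obtain ⟨-, -, ⟨-, a1⟩, a2, -⟩ := hS x hx
    have a1' : (x.1 : ℝ) ≤ 2 * X1 := by exact_mod_cast a1.le
    have a2' : (X2 : ℝ) ≤ x.2.1 := by exact_mod_cast a2
    gcongr
  · obtain ⟨t, hu, -, b1, b2⟩ := hS x hx
    obtain ⟨t', hu', -, b1', b2'⟩ := hS x' hx'
    have p : (0 : ℝ) < x.2.1 := by exact_mod_cast Nat.pos_of_ne_zero t.sq2.ne_zero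
    have p' : (0 : ℝ) < x'.2.1 := by exact_mod_cast Nat.pos_of_ne_zero t'.sq2.ne_zero
    have c2 : (x.2.1 : ℝ) ≤ 2 * X2 := by exact_mod_cast b2.le
    have c2' : (x'.2.1 : ℝ) ≤ 2 * X2 := by exact_mod_cast b2'.le
    have hne0 : (x.1 : ℤ) * x'.2.1 - x'.1 * x.2.1 ≠ 0 := fun h0 =>
      hne (eq_of_cross_eq t t' hu hu' (by exact_mod_cast sub_eq_zero.1 h0))
    have hle := Int.le_of_dvd (abs_pos.2 hne0)
      ((dvd_abs _ _).2 (factorProd_mul_sq_dvd t hu hu'))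
    have hle' : k * y ^ 2 ≤ |(x.1 : ℝ) * x'.2.1 - x'.1 * x.2.1| := by
      have := Int.cast_le (R := ℝ).2 hle
      push_cast at this
      exact this
    have hq : (x.2.1 : ℝ) * x'.2.1 ≤ 4 * X2 ^ 2 := by
      calc (x.2.1 : ℝ) * x'.2.1 ≤ (2 * X2) * (2 * X2) := by gcongr
        _ = _ := by ring
    rw [div_sub_div _ _ p.ne' p'.ne', abs_div, abs_of_pos (mul_pos p p'),
      mul_comm (x.2.1 : ℝ) (x'.1 : ℝ)]
    exact div_le_div₀ (abs_nonneg _) hle' (mul_pos p p') hq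

lemma card_le_two_mul {B : ℝ} (hB : 0 ≤ B) (s : Finset ℤ)
    (hs : ∀ y ∈ s, y ≠ 0 ∧ |(y : ℝ)| ≤ B) : (s.card : ℝ) ≤ 2 * B := by
  have hsub : s ⊆ (Finset.Icc (-(⌊B⌋₊ : ℤ)) ⌊B⌋₊).erase 0 := fun y hy => by
    obtain ⟨a, b⟩ := hs y hy
    have : y.natAbs ≤ ⌊B⌋₊ := Nat.le_floor (by rwa [Nat.cast_natAbs, Int.cast_abs])
    simp only [Finset.mem_erase, Finset.mem_Icc]
    omega
  have hc := Finset.card_le_card hsub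
  rw [Finset.card_erase_of_mem (by simp), Int.card_Icc] at hc
  have h2 : s.card ≤ 2 * ⌊B⌋₊ := by omega
  have h3 : (s.card : ℝ) ≤ 2 * ⌊B⌋₊ := by exact_mod_cast h2
  linarith [Nat.floor_le hB]

/-- The size constraints on a small zero of a form with coefficients of sizes `X1, X2, X3`. -/
structure ZeroInRange (X1 X2 X3 k : ℝ) (y : ℤ × ℤ × ℤ) : Prop where
  pos : 0 < y.2.2
  le : (k * y.2.2) ^ 2 ≤ 16 * (X1 * X2)
  ne1 : y.1 ≠ 0
  ne2 : y.2.1 ≠ 0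
  le1 : X1 * (y.1 : ℝ) ^ 2 ≤ 2 * X3 * (y.2.2 : ℝ) ^ 2
  le2 : X2 * (y.2.1 : ℝ) ^ 2 ≤ 2 * X3 * (y.2.2 : ℝ) ^ 2

theorem sum_zeroInRange_le {X1 X2 X3 k : ℝ} (h1 : 0 < X1) (h2 : 0 < X2) (h3 : 0 < X3)
    (hk : 0 < k) (S : Finset (ℤ × ℤ × ℤ)) (hS : ∀ y ∈ S, ZeroInRange X1 X2 X3 k y) :
    ∑ y ∈ S, 24 * (X1 * X2) / (k * (y.2.2 : ℝ) ^ 2) ≤ 1536 * (X1 * X2 * X3) / k ^ 2 := by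
  have root : ∀ {X : ℝ} {a b : ℤ}, 0 < X → 0 < b → X * (a : ℝ) ^ 2 ≤ 2 * X3 * (b : ℝ) ^ 2 →
      |(a : ℝ)| ≤ b * √(2 * X3 / X) := by
    intro X a b hX hb h
    have hb' : (0 : ℝ) < b := by exact_mod_cast hb
    refine abs_le_of_sq_le_sq ?_ (by positivity)
    rw [mul_pow, Real.sq_sqrt (by positivity), mul_div_assoc', le_div_iff₀ hX]
    linarith
  set M := √(X1 * X2) with hM
  have hM0 : 0 < M := Real.sqrt_pos.2 (by positivity)
  have hM2 : M ^ 2 = X1 * X2 := Real.sq_sqrt (by positivity)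
  rw [← Finset.sum_fiberwise_of_maps_to (g := fun y => y.2.2) (t := S.image fun y => y.2.2)
    fun y hy => Finset.mem_image_of_mem _ hy]
  have hcard : ((S.image fun y => y.2.2).card : ℝ) ≤ 2 * (4 * M / k) := by
    refine card_le_two_mul (by positivity) _ fun b hb => ?_
    obtain ⟨y, hy, rfl⟩ := Finset.mem_image.1 hb
    have hz := hS y hy
    refine ⟨hz.pos.ne', abs_le_of_sq_le_sq ?_ (by positivity)⟩
    rw [div_pow, le_div_iff₀ (by positivity), mul_pow, hM2]
    linarith [hz.le, mul_pow k (y.2.2 : ℝ) 2]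
  have hfib : ∀ b ∈ S.image fun y => y.2.2, ∑ y ∈ S with y.2.2 = b,
      24 * (X1 * X2) / (k * (y.2.2 : ℝ) ^ 2) ≤ 192 * X3 * M / k := by
    intro b hb
    obtain ⟨y0, hy0, rfl⟩ := Finset.mem_image.1 hb
    have hb' : (0 : ℝ) < y0.2.2 := by exact_mod_cast (hS y0 hy0).pos
    set F := S.filter fun y => y.2.2 = y0.2.2 with hF
    have hF' : ∀ y ∈ F, ZeroInRange X1 X2 X3 k y ∧ y.2.2 = y0.2.2 := fun y hy =>
      ⟨hS y (Finset.mem_filter.1 hy).1, (Finset.mem_filter.1 hy).2⟩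
    have hA : ((F.image fun y => y.1).card : ℝ) ≤ 2 * (y0.2.2 * √(2 * X3 / X1)) := by
      refine card_le_two_mul (by positivity) _ fun a ha => ?_
      obtain ⟨y, hy, rfl⟩ := Finset.mem_image.1 ha
      obtain ⟨hz, e⟩ := hF' y hy
      rw [← e]
      exact ⟨hz.ne1, root h1 hz.pos hz.le1⟩
    have hB : ((F.image fun y => y.2.1).card : ℝ) ≤ 2 * (y0.2.2 * √(2 * X3 / X2)) := by
      refine card_le_two_mul (by positivity) _ fun a ha => ?_
      obtain ⟨y, hy, rfl⟩ := Finset.mem_image.1 ha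
      obtain ⟨hz, e⟩ := hF' y hy
      rw [← e]
      exact ⟨hz.ne2, root h2 hz.pos hz.le2⟩
    have hFc : F.card ≤ (F.image fun y => y.1).card * (F.image fun y => y.2.1).card := by
      rw [← Finset.card_product]
      refine Finset.card_le_card_of_injOn (fun y => (y.1, y.2.1)) (fun y hy => ?_) ?_
      · exact Finset.mem_product.2 ⟨Finset.mem_image_of_mem _ hy, Finset.mem_image_of_mem _ hy⟩
      · intro y hy z hz hyz
        have e := (hF' y hy).2.trans (hF' z hz).2.symm
        simp only [Prod.mk.injEq] at hyz
        exact Prod.ext hyz.1 (Prod.ext hyz.2 e)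
    have hroots : √(2 * X3 / X1) * √(2 * X3 / X2) = 2 * X3 / M := by
      rw [← Real.sqrt_mul (by positivity), eq_comm, div_eq_iff hM0.ne', hM,
        ← Real.sqrt_mul (by positivity)]
      have : 2 * X3 / X1 * (2 * X3 / X2) * (X1 * X2) = (2 * X3) ^ 2 := by field_simp
      rw [this, Real.sqrt_sq (by positivity)]
    have hFc' : (F.card : ℝ) ≤ 8 * X3 * (y0.2.2 : ℝ) ^ 2 / M := by
      calc (F.card : ℝ) ≤ (F.image fun y => y.1).card * (F.image fun y => y.2.1).card := by
            exact_mod_cast hFc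
        _ ≤ (2 * (y0.2.2 * √(2 * X3 / X1))) * (2 * (y0.2.2 * √(2 * X3 / X2))) := by gcongr
        _ = 4 * (y0.2.2 : ℝ) ^ 2 * (√(2 * X3 / X1) * √(2 * X3 / X2)) := by ring
        _ = _ := by rw [hroots]; ring
    rw [Finset.sum_congr rfl fun y hy => by rw [(hF' y hy).2], Finset.sum_const, nsmul_eq_mul]
    calc (F.card : ℝ) * (24 * (X1 * X2) / (k * (y0.2.2 : ℝ) ^ 2))
        ≤ 8 * X3 * (y0.2.2 : ℝ) ^ 2 / M * (24 * (X1 * X2) / (k * (y0.2.2 : ℝ) ^ 2)) := by gcongr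
      _ = 192 * X3 * M / k := by rw [← hM2]; field_simp; ring
  calc _ ≤ ((S.image fun y => y.2.2).card : ℝ) * (192 * X3 * M / k) := by
        rw [← nsmul_eq_mul]; exact Finset.sum_le_card_nsmul _ _ _ hfib
    _ ≤ 2 * (4 * M / k) * (192 * X3 * M / k) := by gcongr
    _ = 1536 * (M ^ 2 * X3) / k ^ 2 := by ring
    _ = _ := by rw [hM2]

lemma sum_inv_sq_le_two (R : ℕ) : ∑ c ∈ Finset.Icc 1 R, 1 / (c : ℝ) ^ 2 ≤ 2 := by
  suffices h : ∀ n : ℕ, ∑ c ∈ Finset.Icc 1 (n + 1), 1 / (c : ℝ) ^ 2 ≤ 2 - 1 / ((n : ℝ) + 1) by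
    rcases R with _ | n
    · simp
    · exact (h n).trans (by linarith [show (0 : ℝ) ≤ 1 / ((n : ℝ) + 1) by positivity])
  intro n
  induction n with
  | zero => norm_num
  | succ n ih =>
    rw [Finset.sum_Icc_succ_top (by omega)]
    have : 1 / ((n : ℝ) + 1 + 1) ^ 2 ≤ 1 / (n + 1) - 1 / (n + 1 + 1) := by
      rw [div_sub_div _ _ (by positivity) (by positivity), div_le_div_iff₀ (by positivity)
        (by positivity)]
      nlinarith
    push_cast
    linarith

lemma sum_factorProd_le (R : ℕ) :
    ∑ c ∈ (Finset.Icc 1 R ×ˢ Finset.Icc 1 R) ×ˢ (Finset.Icc 1 R ×ˢ Finset.Icc 1 R) ×ˢ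
      (Finset.Icc 1 R ×ˢ Finset.Icc 1 R), 1 / (factorProd c : ℝ) ^ 2 ≤ 64 := by
  have hpair : ∑ p ∈ Finset.Icc 1 R ×ˢ Finset.Icc 1 R, 1 / ((p.1 * p.2 : ℕ) : ℝ) ^ 2 ≤ 4 := by
    have e : ∑ p ∈ Finset.Icc 1 R ×ˢ Finset.Icc 1 R, 1 / ((p.1 * p.2 : ℕ) : ℝ) ^ 2 =
        (∑ c ∈ Finset.Icc 1 R, 1 / (c : ℝ) ^ 2) * ∑ c ∈ Finset.Icc 1 R, 1 / (c : ℝ) ^ 2 := by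
      rw [Finset.sum_mul_sum, Finset.sum_product]
      refine Finset.sum_congr rfl fun a _ => Finset.sum_congr rfl fun b _ => ?_
      push_cast
      rw [mul_pow, one_div_mul_one_div]
    rw [e]
    have h0 : (0 : ℝ) ≤ ∑ c ∈ Finset.Icc 1 R, 1 / (c : ℝ) ^ 2 :=
      Finset.sum_nonneg fun _ _ => by positivity
    nlinarith [sum_inv_sq_le_two R]
  set T := Finset.Icc 1 R ×ˢ Finset.Icc 1 R
  set f : ℕ × ℕ → ℝ := fun p => 1 / ((p.1 * p.2 : ℕ) : ℝ) ^ 2 with hf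
  have h0 : 0 ≤ ∑ p ∈ T, f p := Finset.sum_nonneg fun _ _ => by positivity
  have e : ∑ c ∈ T ×ˢ T ×ˢ T, 1 / (factorProd c : ℝ) ^ 2 =
      (∑ p ∈ T, f p) * ((∑ p ∈ T, f p) * ∑ p ∈ T, f p) := by
    rw [Finset.sum_product, Finset.sum_mul]
    refine Finset.sum_congr rfl fun a _ => ?_
    rw [Finset.sum_product, Finset.sum_mul, Finset.mul_sum]
    refine Finset.sum_congr rfl fun b _ => ?_
    rw [Finset.mul_sum, Finset.mul_sum]
    refine Finset.sum_congr rfl fun c _ => ?_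
    simp only [hf, factorProd]
    push_cast
    rw [one_div_mul_one_div, one_div_mul_one_div]
    congr 1
    ring
  rw [e]
  calc _ ≤ (4 : ℝ) * (4 * 4) := by gcongr
    _ = _ := by norm_num

/-- The triples for which the form is soluble and at most one coefficient equals `1`. -/
structure SolubleTriple (x : ℕ × ℕ × ℕ) : Prop extends CoprimeTriple x where
  ne12 : ¬ (x.1 = 1 ∧ x.2.1 = 1)
  ne13 : ¬ (x.1 = 1 ∧ x.2.2 = 1)
  ne23 : ¬ (x.2.1 = 1 ∧ x.2.2 = 1)
  soluble : ∃ y1 y2 y3 : ℤ, (y1, y2, y3) ≠ (0, 0, 0) ∧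
    (x.1 : ℤ) * y1 ^ 2 + x.2.1 * y2 ^ 2 = x.2.2 * y3 ^ 2

/-- Membership of a triple in the dyadic box with lower corner `(X1, X2, X3)`. -/
structure InBox (X1 X2 X3 : ℕ) (x : ℕ × ℕ × ℕ) : Prop where
  le1 : X1 ≤ x.1
  lt1 : x.1 < 2 * X1
  le2 : X2 ≤ x.2.1
  lt2 : x.2.1 < 2 * X2
  le3 : X3 ≤ x.2.2
  lt3 : x.2.2 < 2 * X3

lemma InBox.pos {X1 X2 X3 : ℕ} {x : ℕ × ℕ × ℕ} (h : InBox X1 X2 X3 x) :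
    0 < X1 ∧ 0 < X2 ∧ 0 < X3 := by
  obtain ⟨-, h1, -, h2, -, h3⟩ := h
  omega

/-- A finite set containing all small zeros for the coefficients in a dyadic box. -/
noncomputable def zeroBox (R : ℕ) : Finset (((ℕ × ℕ) × (ℕ × ℕ) × (ℕ × ℕ)) × (ℤ × ℤ × ℤ)) :=
  ((Finset.Icc 1 R ×ˢ Finset.Icc 1 R) ×ˢ (Finset.Icc 1 R ×ˢ Finset.Icc 1 R) ×ˢ
    (Finset.Icc 1 R ×ˢ Finset.Icc 1 R)) ×ˢ
  (Finset.Icc (-(R : ℤ)) R ×ˢ Finset.Icc (-(R : ℤ)) R ×ˢ Finset.Icc (-(R : ℤ)) R)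

lemma SmallZero.mem_zeroBox {X1 X2 X3 : ℕ} {x : ℕ × ℕ × ℕ} (hx : CoprimeTriple x)
    (hb : InBox X1 X2 X3 x) {u : ((ℕ × ℕ) × (ℕ × ℕ) × (ℕ × ℕ)) × (ℤ × ℤ × ℤ)}
    (hu : SmallZero x.1 x.2.1 x.2.2 u) : u ∈ zeroBox (32 * (X1 * X2 * X3)) := by
  obtain ⟨p1, p2, p3⟩ := hb.pos
  have q1 := Nat.pos_of_ne_zero hx.sq1.ne_zero
  have q2 := Nat.pos_of_ne_zero hx.sq2.ne_zero
  have q3 := Nat.pos_of_ne_zero hx.sq3.ne_zero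
  set P := X1 * X2 * X3 with hP
  have l1 : X1 ≤ P := by rw [hP, mul_assoc]; exact Nat.le_mul_of_pos_right _ (by positivity)
  have l2 : X2 ≤ P := by
    rw [hP, mul_comm X1, mul_assoc]; exact Nat.le_mul_of_pos_right _ (by positivity)
  have l3 : X3 ≤ P := Nat.le_mul_of_pos_left _ (by positivity)
  have fac : ∀ {a b n : ℕ}, 0 < n → n ≤ 32 * P → a * b ∣ n →
      (a, b) ∈ Finset.Icc 1 (32 * P) ×ˢ Finset.Icc 1 (32 * P) := by
    intro a b n hn hnP hab
    have ha := Nat.pos_of_dvd_of_pos ((Dvd.intro _ rfl).trans hab) hn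
    have hb := Nat.pos_of_dvd_of_pos ((Dvd.intro_left _ rfl).trans hab) hn
    have ha' := Nat.le_of_dvd hn ((Dvd.intro _ rfl).trans hab)
    have hb' := Nat.le_of_dvd hn ((Dvd.intro_left _ rfl).trans hab)
    simp only [Finset.mem_product, Finset.mem_Icc]
    omega
  have hz3 : (x.2.2 : ℤ) * u.2.2.2 ^ 2 ≤ (32 * P : ℕ) := by
    have hk : (1 : ℤ) ≤ (factorProd u.1 : ℤ) ^ 2 :=
      one_le_pow₀ (by exact_mod_cast hu.one_le_factorProd hx)
    have hb2 : (factorProd u.1 : ℤ) ^ 2 * u.2.2.2 ^ 2 < 4 * x.1 * x.2.1 := by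
      simpa only [factorProd, Nat.cast_mul] using hu.bound
    have hy : u.2.2.2 ^ 2 ≤ 4 * x.1 * x.2.1 := by nlinarith [sq_nonneg u.2.2.2]
    have m1 : (x.1 : ℤ) ≤ 2 * X1 := by exact_mod_cast hb.lt1.le
    have m2 : (x.2.1 : ℤ) ≤ 2 * X2 := by exact_mod_cast hb.lt2.le
    have m3 : (x.2.2 : ℤ) ≤ 2 * X3 := by exact_mod_cast hb.lt3.le
    calc (x.2.2 : ℤ) * u.2.2.2 ^ 2 ≤ 2 * X3 * (4 * (2 * X1) * (2 * X2)) := by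
          refine mul_le_mul m3 (hy.trans ?_) (sq_nonneg _) (by positivity)
          gcongr
      _ = (32 * P : ℕ) := by rw [hP]; push_cast; ring
  have hzero := hu.zero
  have n1 : (0 : ℤ) ≤ x.1 * u.2.1 ^ 2 := by positivity
  have n2 : (0 : ℤ) ≤ x.2.1 * u.2.2.1 ^ 2 := by positivity
  have box : ∀ {a : ℕ} {y : ℤ}, 0 < a → (a : ℤ) * y ^ 2 ≤ (32 * P : ℕ) →
      y ∈ Finset.Icc (-((32 * P : ℕ) : ℤ)) (32 * P : ℕ) := by
    intro a y ha h
    have ha' : (1 : ℤ) ≤ a := by exact_mod_cast ha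
    have : y ^ 2 ≤ (32 * P : ℕ) := by nlinarith [sq_nonneg y]
    rw [Finset.mem_Icc]
    constructor <;> nlinarith
  obtain ⟨⟨⟨c1, b1⟩, ⟨c2, b2⟩, c3, b3⟩, y1, y2, y3⟩ := u
  have e1 := fac q1 (by have := hb.lt1; omega) hu.dvd1
  have e2 := fac q2 (by have := hb.lt2; omega) hu.dvd2
  have e3 := fac q3 (by have := hb.lt3; omega) hu.dvd3
  exact Finset.mem_product.2 ⟨Finset.mem_product.2 ⟨e1, Finset.mem_product.2 ⟨e2, e3⟩⟩,
    Finset.mem_product.2 ⟨box q1 (by linarith), Finset.mem_product.2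
      ⟨box q2 (by linarith), box q3 hz3⟩⟩⟩

lemma SmallZero.zeroInRange {X1 X2 X3 : ℕ} {x : ℕ × ℕ × ℕ} (hb : InBox X1 X2 X3 x)
    {u : ((ℕ × ℕ) × (ℕ × ℕ) × (ℕ × ℕ)) × (ℤ × ℤ × ℤ)}
    (hu : SmallZero x.1 x.2.1 x.2.2 u) : ZeroInRange X1 X2 X3 (factorProd u.1) u.2 := by
  have hz : (x.1 : ℝ) * u.2.1 ^ 2 + x.2.1 * u.2.2.1 ^ 2 = x.2.2 * u.2.2.2 ^ 2 := by
    exact_mod_cast hu.zero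
  have m1 : (X1 : ℝ) * (u.2.1 : ℝ) ^ 2 ≤ x.1 * (u.2.1 : ℝ) ^ 2 := by
    gcongr; exact_mod_cast hb.le1
  have m2 : (X2 : ℝ) * (u.2.2.1 : ℝ) ^ 2 ≤ x.2.1 * (u.2.2.1 : ℝ) ^ 2 := by
    gcongr; exact_mod_cast hb.le2
  have m3 : x.2.2 * (u.2.2.2 : ℝ) ^ 2 ≤ 2 * X3 * (u.2.2.2 : ℝ) ^ 2 := by
    gcongr; exact_mod_cast hb.lt3.le
  have n1 : (0 : ℝ) ≤ x.1 * (u.2.1 : ℝ) ^ 2 := by positivity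
  have n2 : (0 : ℝ) ≤ x.2.1 * (u.2.2.1 : ℝ) ^ 2 := by positivity
  exact ⟨hu.pos, (hu.factorProd_mul_sq_lt hb.lt1 hb.lt2).le, hu.ne1, hu.ne2, by linarith,
    by linarith⟩

open scoped Classical in
theorem sum_card_divisors_le_of_inBox {X1 X2 X3 : ℕ} (G : Finset (ℕ × ℕ × ℕ))
    (hG : ∀ x ∈ G, SolubleTriple x ∧ InBox X1 X2 X3 x) :
    ∑ x ∈ G, ((x.1 * x.2.1 * x.2.2).divisors.card : ℝ) ≤ 196608 * (X1 * X2 * X3) := by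
  rcases G.eq_empty_or_nonempty with rfl | ⟨x0, hx0⟩
  · rw [Finset.sum_empty]; positivity
  obtain ⟨p1, p2, p3⟩ := (hG x0 hx0).2.pos
  have p1' : (0 : ℝ) < X1 := by exact_mod_cast p1
  have p2' : (0 : ℝ) < X2 := by exact_mod_cast p2
  have p3' : (0 : ℝ) < X3 := by exact_mod_cast p3
  set R := 32 * (X1 * X2 * X3) with hR
  have hdiv : ∀ x ∈ G, (x.1 * x.2.1 * x.2.2).divisors.card ≤
      2 * ((zeroBox R).filter fun u => SmallZero x.1 x.2.1 x.2.2 u).card := by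
    intro x hx
    obtain ⟨h, hb⟩ := hG x hx
    exact card_divisors_le_two_mul_card h.sq1 h.sq2 h.sq3 h.co12 h.co13 h.co23 h.ne12 h.ne13
      h.ne23 h.soluble _ fun u hu =>
        Finset.mem_filter.2 ⟨hu.mem_zeroBox h.toCoprimeTriple hb, hu⟩
  have hswap : ∑ x ∈ G, ((zeroBox R).filter fun u => SmallZero x.1 x.2.1 x.2.2 u).card =
      ∑ u ∈ zeroBox R, (G.filter fun x => SmallZero x.1 x.2.1 x.2.2 u).card :=
    Finset.sum_card_bipartiteAbove_eq_sum_card_bipartiteBelow _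
  have hfib : ∀ u ∈ zeroBox R, ((G.filter fun x => SmallZero x.1 x.2.1 x.2.2 u).card : ℝ) ≤
      if ZeroInRange X1 X2 X3 (factorProd u.1) u.2 then
        (24 * (X1 * X2) / (factorProd u.1 * (u.2.2.2 : ℝ) ^ 2) : ℝ) else 0 := by
    intro u _
    split_ifs with h
    · refine card_triples_le _ u fun x hx => ?_
      obtain ⟨hxG, hu⟩ := Finset.mem_filter.1 hx
      obtain ⟨ht, hb⟩ := hG x hxG
      exact ⟨ht.toCoprimeTriple, hu, ⟨hb.le1, hb.lt1⟩, hb.le2, hb.lt2⟩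
    · rw [Finset.filter_eq_empty_iff.2 fun x hx hu => h (hu.zeroInRange (hG x hx).2)]
      simp
  have hsum : ∑ u ∈ zeroBox R, (if ZeroInRange X1 X2 X3 (factorProd u.1) u.2 then
        (24 * (X1 * X2) / (factorProd u.1 * (u.2.2.2 : ℝ) ^ 2) : ℝ) else 0) ≤
      1536 * (X1 * X2 * X3) * 64 := by
    rw [zeroBox, Finset.sum_product]
    refine le_trans (Finset.sum_le_sum (g := fun c =>
      1536 * (X1 * X2 * X3 : ℝ) * (1 / (factorProd c : ℝ) ^ 2)) fun c hc => ?_) ?_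
    · have hc0 : 0 < factorProd c := by
        simp only [Finset.mem_product, Finset.mem_Icc] at hc
        obtain ⟨⟨⟨_, _⟩, _, _⟩, ⟨⟨_, _⟩, _, _⟩, ⟨_, _⟩, _, _⟩ := hc
        unfold factorProd
        positivity
      rw [← Finset.sum_filter, mul_one_div]
      exact sum_zeroInRange_le p1' p2' p3' (k := (factorProd c : ℝ)) (by exact_mod_cast hc0) _
        fun y hy => (Finset.mem_filter.1 hy).2
    · rw [← Finset.mul_sum]
      gcongr
      exact sum_factorProd_le R
  calc ∑ x ∈ G, ((x.1 * x.2.1 * x.2.2).divisors.card : ℝ)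
      ≤ ∑ x ∈ G, 2 * (((zeroBox R).filter fun u => SmallZero x.1 x.2.1 x.2.2 u).card : ℝ) :=
        Finset.sum_le_sum fun x hx => by exact_mod_cast hdiv x hx
    _ = 2 * ∑ u ∈ zeroBox R, ((G.filter fun x => SmallZero x.1 x.2.1 x.2.2 u).card : ℝ) := by
        rw [← Finset.mul_sum]; congr 1; exact_mod_cast hswap
    _ ≤ 2 * (1536 * (X1 * X2 * X3) * 64) := by
        gcongr; exact (Finset.sum_le_sum hfib).trans hsum
    _ = _ := by ring

lemma sum_inv_le_one_add_log (N : ℕ) : ∑ m ∈ Finset.Icc 1 N, 1 / (m : ℝ) ≤ 1 + log N := by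
  have h := harmonic_le_one_add_log N
  rw [harmonic_eq_sum_Icc] at h
  push_cast at h
  simpa only [one_div] using h

lemma sum_card_divisors_div_le (N : ℕ) :
    ∑ x ∈ Finset.Icc 1 N, (x.divisors.card : ℝ) / x ≤ (1 + log N) ^ 2 := by
  have hx : ∀ x ∈ Finset.Icc 1 N, (x.divisors.card : ℝ) / x ≤
      ∑ p ∈ Finset.Icc 1 N ×ˢ Finset.Icc 1 N with p.1 * p.2 = x,
        1 / (p.1 : ℝ) * (1 / (p.2 : ℝ)) := by
    intro x hx
    rw [Finset.mem_Icc] at hx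
    have hc : x.divisors.card ≤
        (Finset.filter (fun p => p.1 * p.2 = x) (Finset.Icc 1 N ×ˢ Finset.Icc 1 N)).card := by
      refine Finset.card_le_card_of_injOn (fun a => (a, x / a)) (fun a ha => ?_)
        fun a _ b _ hab => (Prod.ext_iff.1 hab).1
      have ha' := Nat.dvd_of_mem_divisors ha
      have h1 := Nat.le_of_dvd hx.1 ha'
      have h2 := Nat.pos_of_dvd_of_pos ha' hx.1
      have h3 := Nat.div_le_self x a
      have h4 := Nat.div_pos h1 h2
      simp only [Finset.coe_filter, Finset.mem_product, Finset.mem_Icc, Set.mem_ofPred_eq]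
      exact ⟨by omega, Nat.mul_div_cancel' ha'⟩
    have hs : ∑ p ∈ Finset.Icc 1 N ×ˢ Finset.Icc 1 N with p.1 * p.2 = x,
        1 / (p.1 : ℝ) * (1 / (p.2 : ℝ)) =
        (Finset.filter (fun p => p.1 * p.2 = x) (Finset.Icc 1 N ×ˢ Finset.Icc 1 N)).card *
          (1 / (x : ℝ)) := by
      rw [← nsmul_eq_mul, ← Finset.sum_const]
      refine Finset.sum_congr rfl fun p hp => ?_
      rw [← (Finset.mem_filter.1 hp).2, one_div_mul_one_div, Nat.cast_mul]
    rw [hs, ← mul_one_div]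
    gcongr
  have h0 : 0 ≤ ∑ m ∈ Finset.Icc 1 N, 1 / (m : ℝ) := Finset.sum_nonneg fun _ _ => by positivity
  calc _ ≤ _ := Finset.sum_le_sum hx
    _ ≤ ∑ p ∈ Finset.Icc 1 N ×ˢ Finset.Icc 1 N, 1 / (p.1 : ℝ) * (1 / (p.2 : ℝ)) :=
        Finset.sum_fiberwise_le_sum_of_sum_fiber_nonneg
          fun _ _ => Finset.sum_nonneg fun _ _ => by positivity
    _ = (∑ m ∈ Finset.Icc 1 N, 1 / (m : ℝ)) ^ 2 := by
        rw [sq, Finset.sum_mul_sum, Finset.sum_product]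
    _ ≤ _ := by gcongr; exact sum_inv_le_one_add_log N

/-- The summand `d(x1 * x2 * x3) / (x1 * x2 * x3)`. -/
noncomputable def divisorWeight (t : ℕ × ℕ × ℕ) : ℝ :=
  ((t.1 * t.2.1 * t.2.2).divisors.card : ℝ) / ((t.1 * t.2.1 * t.2.2 : ℕ) : ℝ)

lemma divisorWeight_nonneg (t : ℕ × ℕ × ℕ) : 0 ≤ divisorWeight t := by
  unfold divisorWeight; positivity

lemma sum_divisorWeight_inBox_le {X1 X2 X3 : ℕ} (G : Finset (ℕ × ℕ × ℕ))
    (hG : ∀ x ∈ G, SolubleTriple x ∧ InBox X1 X2 X3 x) :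
    ∑ x ∈ G, divisorWeight x ≤ 196608 := by
  rcases G.eq_empty_or_nonempty with rfl | ⟨x0, hx0⟩
  · simp
  obtain ⟨p1, p2, p3⟩ := (hG x0 hx0).2.pos
  have hP : (0 : ℝ) < X1 * X2 * X3 := by positivity
  calc ∑ x ∈ G, divisorWeight x
      ≤ ∑ x ∈ G, ((x.1 * x.2.1 * x.2.2).divisors.card : ℝ) / (X1 * X2 * X3) := by
        refine Finset.sum_le_sum fun x hx => ?_
        obtain ⟨-, hb⟩ := hG x hx
        have h : X1 * X2 * X3 ≤ x.1 * x.2.1 * x.2.2 :=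
          Nat.mul_le_mul (Nat.mul_le_mul hb.le1 hb.le2) hb.le3
        unfold divisorWeight
        gcongr
        exact_mod_cast h
    _ ≤ _ := by
        rw [← Finset.sum_div, div_le_iff₀ hP]
        exact sum_card_divisors_le_of_inBox G hG

lemma sum_divisorWeight_soluble_le {N : ℕ} (G : Finset (ℕ × ℕ × ℕ))
    (hG : ∀ x ∈ G, SolubleTriple x ∧ x.1 ≤ N ∧ x.2.1 ≤ N ∧ x.2.2 ≤ N) :
    ∑ x ∈ G, divisorWeight x ≤ 196608 * ((Nat.log 2 N + 1 : ℕ) : ℝ) ^ 3 := by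
  set L := Nat.log 2 N + 1 with hL
  have hmaps : ∀ x ∈ G, (Nat.log 2 x.1, Nat.log 2 x.2.1, Nat.log 2 x.2.2) ∈
      Finset.range L ×ˢ Finset.range L ×ˢ Finset.range L := fun x hx => by
    obtain ⟨-, h1, h2, h3⟩ := hG x hx
    simp only [Finset.mem_product, Finset.mem_range, hL, Nat.lt_succ_iff]
    exact ⟨Nat.log_mono_right h1, Nat.log_mono_right h2, Nat.log_mono_right h3⟩
  rw [← Finset.sum_fiberwise_of_maps_to hmaps]
  refine (Finset.sum_le_card_nsmul _ _ 196608 fun e _ => ?_).trans_eq ?_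
  · refine sum_divisorWeight_inBox_le (X1 := 2 ^ e.1) (X2 := 2 ^ e.2.1) (X3 := 2 ^ e.2.2) _
      fun x hx => ?_
    obtain ⟨hxG, rfl⟩ := Finset.mem_filter.1 hx
    have h := (hG x hxG).1
    refine ⟨h, Nat.pow_log_le_self 2 h.sq1.ne_zero, ?_, Nat.pow_log_le_self 2 h.sq2.ne_zero, ?_,
      Nat.pow_log_le_self 2 h.sq3.ne_zero, ?_⟩ <;>
    · rw [← pow_succ']
      exact Nat.lt_pow_succ_log_self (by norm_num) _
  · rw [Finset.card_product, Finset.card_product, Finset.card_range, nsmul_eq_mul]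
    push_cast
    ring

open scoped Classical in
lemma solubleFormSum_le_add (X : ℝ) :
    solubleFormSum X ≤ ∑ t ∈ Finset.filter SolubleTriple
        (Finset.Icc 1 ⌊X⌋₊ ×ˢ Finset.Icc 1 ⌊X⌋₊ ×ˢ Finset.Icc 1 ⌊X⌋₊), divisorWeight t +
      3 * ∑ x ∈ Finset.Icc 1 ⌊X⌋₊, (x.divisors.card : ℝ) / x := by
  rcases Nat.eq_zero_or_pos ⌊X⌋₊ with h0 | hN
  · simp [solubleFormSum, h0]
  set I := Finset.Icc 1 ⌊X⌋₊ with hI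
  have h1 : 1 ∈ I := Finset.mem_Icc.2 ⟨le_rfl, hN⟩
  have e12 : ∑ t ∈ I ×ˢ I ×ˢ I, (if t.1 = 1 ∧ t.2.1 = 1 then divisorWeight t else 0) =
      ∑ x ∈ I, (x.divisors.card : ℝ) / x := by
    simp only [Finset.sum_product, ite_and, Finset.sum_ite_irrel, Finset.sum_const_zero,
      Finset.sum_ite_eq', h1, if_true, divisorWeight, one_mul]
  have e13 : ∑ t ∈ I ×ˢ I ×ˢ I, (if t.1 = 1 ∧ t.2.2 = 1 then divisorWeight t else 0) =
      ∑ x ∈ I, (x.divisors.card : ℝ) / x := by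
    simp only [Finset.sum_product, ite_and, Finset.sum_ite_irrel, Finset.sum_const_zero,
      Finset.sum_ite_eq', h1, if_true, divisorWeight, one_mul, mul_one]
  have e23 : ∑ t ∈ I ×ˢ I ×ˢ I, (if t.2.1 = 1 ∧ t.2.2 = 1 then divisorWeight t else 0) =
      ∑ x ∈ I, (x.divisors.card : ℝ) / x := by
    simp only [Finset.sum_product, ite_and, Finset.sum_ite_irrel, Finset.sum_const_zero,
      Finset.sum_ite_eq', h1, if_true, divisorWeight, mul_one]
  have key : solubleFormSum X ≤ ∑ t ∈ I ×ˢ I ×ˢ I,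
      ((if SolubleTriple t then divisorWeight t else 0) +
      ((if t.1 = 1 ∧ t.2.1 = 1 then divisorWeight t else 0) +
      ((if t.1 = 1 ∧ t.2.2 = 1 then divisorWeight t else 0) +
      (if t.2.1 = 1 ∧ t.2.2 = 1 then divisorWeight t else 0)))) := by
    refine Finset.sum_le_sum fun t _ => ?_
    have w := divisorWeight_nonneg t
    have outer : ∀ (p : Prop) [Decidable p] (a b : ℝ), (p → a ≤ b) → 0 ≤ b →
        (if p then a else 0) ≤ b := fun p _ a b hab hb => by
      split_ifs with hp
      exacts [hab hp, hb]
    have nn : ∀ (p : Prop) [Decidable p], 0 ≤ if p then divisorWeight t else 0 :=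
      fun p _ => by split_ifs <;> simp [w]
    have n0 := nn (SolubleTriple t)
    have n1 := nn (t.1 = 1 ∧ t.2.1 = 1)
    have n2 := nn (t.1 = 1 ∧ t.2.2 = 1)
    have n3 := nn (t.2.1 = 1 ∧ t.2.2 = 1)
    refine outer _ _ _ (fun h => ?_) (by linarith)
    change divisorWeight t ≤ _
    obtain ⟨c12, c13, c23, s1, s2, s3, -, hsol⟩ := h
    by_cases a12 : t.1 = 1 ∧ t.2.1 = 1
    · rw [if_pos a12]; linarith
    by_cases a13 : t.1 = 1 ∧ t.2.2 = 1
    · rw [if_pos a13]; linarith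
    by_cases a23 : t.2.1 = 1 ∧ t.2.2 = 1
    · rw [if_pos a23]; linarith
    rw [if_pos (show SolubleTriple t from ⟨⟨s1, s2, s3, c12, c13, c23⟩, a12, a13, a23, hsol⟩)]
    linarith
  rw [Finset.sum_add_distrib, Finset.sum_add_distrib, Finset.sum_add_distrib, e12, e13, e23,
    ← Finset.sum_filter] at key
  linarith

theorem solubleFormSum_upper :
    ∃ C : ℝ, 0 < C ∧ ∃ X0 : ℝ, 2 ≤ X0 ∧
      ∀ X : ℝ, X0 ≤ X → solubleFormSum X ≤ C * (Real.log X) ^ 3 := by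
  classical
  refine ⟨196608 * 27 + 12, by norm_num, 3, by norm_num, fun X hX => ?_⟩
  have hl : 1 ≤ log X := by
    rw [le_log_iff_exp_le (by linarith)]
    linarith [exp_one_lt_d9]
  have hfloor : (⌊X⌋₊ : ℝ) ≤ X := Nat.floor_le (by linarith)
  have hN : 0 < ⌊X⌋₊ := Nat.floor_pos.2 (by linarith)
  have hlogN : log ⌊X⌋₊ ≤ log X := log_le_log (by exact_mod_cast hN) hfloor
  have hL : ((Nat.log 2 ⌊X⌋₊ + 1 : ℕ) : ℝ) ≤ 3 * log X := by
    have h2 : (Nat.log 2 ⌊X⌋₊ : ℝ) * log 2 ≤ log X := by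
      rw [← log_pow]
      refine (log_le_log (by positivity) ?_).trans hlogN
      exact_mod_cast Nat.pow_log_le_self 2 hN.ne'
    have h3 : (0 : ℝ) ≤ Nat.log 2 ⌊X⌋₊ := by positivity
    push_cast
    nlinarith [log_two_gt_d9]
  have hgood := sum_divisorWeight_soluble_le (N := ⌊X⌋₊) (Finset.filter SolubleTriple
    (Finset.Icc 1 ⌊X⌋₊ ×ˢ Finset.Icc 1 ⌊X⌋₊ ×ˢ Finset.Icc 1 ⌊X⌋₊)) fun x hx => by
      simp only [Finset.mem_filter, Finset.mem_product, Finset.mem_Icc] at hx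
      exact ⟨hx.2, hx.1.1.2, hx.1.2.1.2, hx.1.2.2.2⟩
  have hlog0 : 0 ≤ log (⌊X⌋₊ : ℝ) := log_natCast_nonneg _
  calc solubleFormSum X ≤ _ := solubleFormSum_le_add X
    _ ≤ 196608 * (3 * log X) ^ 3 + 3 * (log X + log X) ^ 2 := by
        refine add_le_add (hgood.trans (by gcongr)) ?_
        refine mul_le_mul_of_nonneg_left ((sum_card_divisors_div_le _).trans ?_) (by norm_num)
        gcongr
    _ = 196608 * 27 * log X ^ 3 + 12 * log X ^ 2 := by ring
    _ ≤ 196608 * 27 * log X ^ 3 + 12 * log X ^ 3 := by gcongr; norm_num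
    _ = _ := by ring
end

section
/- Let x1, x2, x3 be pairwise coprime squarefree positive integers. Then the equation x1*y1^2 + x2*y2^2 = x3*y3^2 has a solution in integers (y1, y2, y3) ≠ (0, 0, 0) if and only if x2*x3 is a square modulo x1, x1*x3 is a square modulo x2, and -x1*x2 is a square modulo x3. -/
open Real

/-- `a` is a square modulo `m`. -/
def IsSquareMod (a : ℤ) (m : ℤ) : Prop := ∃ z : ℤ, m ∣ z ^ 2 - a

/-- A nontrivial integral zero of a ternary diagonal form can be made primitive. -/
lemma exists_primitive_zero {a b c x y z : ℤ} (hne : (x, y, z) ≠ (0, 0, 0))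
    (h : a * x ^ 2 + b * y ^ 2 + c * z ^ 2 = 0) :
    ∃ u v w : ℤ, (∀ p : ℤ, Prime p → p ∣ u → p ∣ v → ¬ p ∣ w) ∧
      a * u ^ 2 + b * v ^ 2 + c * w ^ 2 = 0 := by
  obtain ⟨g, hg, hg1⟩ := Finset.extract_gcd (s := Finset.univ) ![x, y, z] Finset.univ_nonempty
  set d := Finset.univ.gcd ![x, y, z]
  have hx : x = d * g 0 := hg 0 (Finset.mem_univ _)
  have hy : y = d * g 1 := hg 1 (Finset.mem_univ _)
  have hz : z = d * g 2 := hg 2 (Finset.mem_univ _)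
  have hd : d ≠ 0 := by
    intro hd
    apply hne
    simp [hx, hy, hz, hd]
  refine ⟨g 0, g 1, g 2, fun p hp h0 h1 h2 => hp.not_dvd_one ?_, ?_⟩
  · rw [← hg1]
    refine Finset.dvd_gcd fun i _ => ?_
    fin_cases i <;> assumption
  · have : d ^ 2 * (a * g 0 ^ 2 + b * g 1 ^ 2 + c * g 2 ^ 2) = 0 := by
      rw [← h, hx, hy, hz]
      ring
    exact (mul_eq_zero.mp this).resolve_left (pow_ne_zero 2 hd)

/-- A zero of `a x² + b y² + c z²` makes `-b c` a square modulo the squarefree coefficient `a`. -/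
lemma isSquareMod_of_zero {a b c x y z : ℤ} (ha : Squarefree a) (hac : IsCoprime a c)
    (hne : (x, y, z) ≠ (0, 0, 0)) (h : a * x ^ 2 + b * y ^ 2 + c * z ^ 2 = 0) :
    IsSquareMod (-(b * c)) a := by
  obtain ⟨u, v, w, hprim, huvw⟩ := exists_primitive_zero hne h
  have hav : IsCoprime a v := by
    refine isCoprime_of_prime_dvd (fun h0 => ha.ne_zero h0.1) fun p hp hpa hpv => ?_
    have hpw : p ∣ w := by
      have h1 : p ∣ c * w ^ 2 := by
        have : c * w ^ 2 = -(a * u ^ 2 + b * v ^ 2) := by linarith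
        rw [this]
        exact (dvd_add (hpa.mul_right _) ((dvd_pow hpv two_ne_zero).mul_left _)).neg_right
      refine hp.dvd_of_dvd_pow ((hp.dvd_or_dvd h1).resolve_left fun hpc => ?_)
      exact hp.not_isUnit (hac.isUnit_of_dvd' hpa hpc)
    have hpu : p ∣ u := by
      by_contra hpu
      obtain ⟨v', rfl⟩ := hpv
      obtain ⟨w', rfl⟩ := hpw
      have h2 : p ^ 2 ∣ a * u ^ 2 := ⟨-(b * v' ^ 2 + c * w' ^ 2), by linarith⟩
      have hcop : IsCoprime (p ^ 2) (u ^ 2) :=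
        ((Prime.coprime_iff_not_dvd hp).mpr hpu).pow
      have h3 := hcop.dvd_of_dvd_mul_right h2
      rw [sq] at h3
      exact hp.not_isUnit (ha p h3)
    exact hprim p hp hpu hpv hpw
  obtain ⟨r, s, hrs⟩ := hav
  refine ⟨c * w * s, -(c * s ^ 2 * u ^ 2) + b * c * r * (1 + s * v), ?_⟩
  linear_combination c * s ^ 2 * huvw - b * c * (1 + s * v) * hrs

/-- A product of coprime squarefree positive integers is a square only if both are `1`. -/
lemma eq_one_of_sq_eq_mul {a b x : ℤ} (ha : 0 < a) (hb : 0 < b) (hsa : Squarefree a)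
    (hsb : Squarefree b) (hab : IsCoprime a b) (h : x ^ 2 = a * b) : a = 1 ∧ b = 1 := by
  have hs : Squarefree (a * b) := (squarefree_mul_iff).mpr ⟨hab.isRelPrime, hsa, hsb⟩
  have hu : IsUnit (a * b) := by
    rw [← h]
    exact (hs x ⟨1, by rw [← h]; ring⟩).pow 2
  have h1 : IsUnit a := isUnit_of_mul_isUnit_left hu
  have h2 : IsUnit b := isUnit_of_mul_isUnit_right hu
  rw [Int.isUnit_iff] at h1 h2
  omega

/-- Pigeonhole: three linear congruences modulo `a`, `b`, `c` have a nonzero common solution in the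
box `x² ≤ b c`, `y² ≤ a c`, `z² ≤ a b`. -/
lemma exists_small_solution (a b c : ℕ) [NeZero a] [NeZero b] [NeZero c]
    (l₁ m₁ l₂ m₂ l₃ m₃ : ℤ) :
    ∃ x y z : ℤ, (x, y, z) ≠ (0, 0, 0) ∧ x ^ 2 ≤ b * c ∧ y ^ 2 ≤ a * c ∧ z ^ 2 ≤ a * b ∧
      (a : ℤ) ∣ l₁ * y - m₁ * z ∧ (b : ℤ) ∣ l₂ * x - m₂ * z ∧ (c : ℤ) ∣ l₃ * x - m₃ * y := by
  let F : Fin (Nat.sqrt (b * c) + 1) × Fin (Nat.sqrt (a * c) + 1) × Fin (Nat.sqrt (a * b) + 1) →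
      ZMod a × ZMod b × ZMod c := fun t =>
    (l₁ * (t.2.1 : ℕ) - m₁ * (t.2.2 : ℕ), l₂ * (t.1 : ℕ) - m₂ * (t.2.2 : ℕ),
      l₃ * (t.1 : ℕ) - m₃ * (t.2.1 : ℕ))
  have hcard : Fintype.card (ZMod a × ZMod b × ZMod c) <
      Fintype.card (Fin (Nat.sqrt (b * c) + 1) × Fin (Nat.sqrt (a * c) + 1) ×
        Fin (Nat.sqrt (a * b) + 1)) := by
    simp only [Fintype.card_prod, ZMod.card, Fintype.card_fin]
    refine lt_of_pow_lt_pow_left₀ 2 (Nat.zero_le _) ?_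
    calc (a * (b * c)) ^ 2 = (b * c) * ((a * c) * (a * b)) := by ring
      _ < (Nat.sqrt (b * c) + 1) ^ 2 *
          ((Nat.sqrt (a * c) + 1) ^ 2 * (Nat.sqrt (a * b) + 1) ^ 2) := by
        have h1 := Nat.lt_succ_sqrt' (b * c)
        have h2 := Nat.lt_succ_sqrt' (a * c)
        have h3 := Nat.lt_succ_sqrt' (a * b)
        exact Nat.mul_lt_mul'' h1 (Nat.mul_lt_mul'' h2 h3)
      _ = _ := by ring
  obtain ⟨s, t, hst, hF⟩ := Fintype.exists_ne_map_eq_of_card_lt F hcard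
  have bound : ∀ {n : ℕ} (i j : Fin (Nat.sqrt n + 1)), ((i : ℤ) - (j : ℤ)) ^ 2 ≤ n := by
    intro n i j
    have hn : ((Nat.sqrt n : ℕ) : ℤ) ^ 2 ≤ n := by exact_mod_cast Nat.sqrt_le' n
    refine le_trans (sq_le_sq' ?_ ?_) hn <;> omega
  simp only [F, Prod.mk.injEq] at hF
  obtain ⟨h1, h2, h3⟩ := hF
  refine ⟨(s.1 : ℤ) - t.1, (s.2.1 : ℤ) - t.2.1, (s.2.2 : ℤ) - t.2.2, ?_, ?_, ?_, ?_, ?_, ?_, ?_⟩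
  · intro h0
    simp only [Prod.mk.injEq] at h0
    apply hst
    ext <;> omega
  · exact_mod_cast bound s.1 t.1
  · exact_mod_cast bound s.2.1 t.2.1
  · exact_mod_cast bound s.2.2 t.2.2
  · rw [← ZMod.intCast_zmod_eq_zero_iff_dvd]
    push_cast
    linear_combination h1
  · rw [← ZMod.intCast_zmod_eq_zero_iff_dvd]
    push_cast
    linear_combination h2
  · rw [← ZMod.intCast_zmod_eq_zero_iff_dvd]
    push_cast
    linear_combination h3

/-- The composition identity turning a representation of `a b c` into a zero of the form. -/
lemma exists_zero_of_eq_mul {a b c x y z : ℤ} (ha : 0 < a) (hb : 0 < b)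
    (h : a * x ^ 2 + b * y ^ 2 - c * z ^ 2 = a * b * c) :
    ∃ y1 y2 y3 : ℤ, (y1, y2, y3) ≠ (0, 0, 0) ∧ a * y1 ^ 2 + b * y2 ^ 2 = c * y3 ^ 2 := by
  refine ⟨x * z - b * y, y * z + a * x, z ^ 2 + a * b, ?_, ?_⟩
  · intro h0
    simp only [Prod.mk.injEq] at h0
    have : 0 < z ^ 2 + a * b := by positivity
    omega
  · linear_combination (z ^ 2 + a * b) * h

/-- If `-1` is a square modulo `c > 0`, then `y1² + y2² = c y3²` has a nontrivial zero. -/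
lemma exists_zero_of_isSquareMod_neg_one {c : ℤ} (hc : 0 < c) (h : IsSquareMod (-1) c) :
    ∃ y1 y2 y3 : ℤ, (y1, y2, y3) ≠ (0, 0, 0) ∧ y1 ^ 2 + y2 ^ 2 = c * y3 ^ 2 := by
  lift c to ℕ using hc.le
  obtain ⟨z, hz⟩ := h
  have hsq : IsSquare (-1 : ZMod c) := by
    refine ⟨(z : ZMod c), ?_⟩
    rw [← ZMod.intCast_zmod_eq_zero_iff_dvd] at hz
    push_cast at hz
    linear_combination -hz
  obtain ⟨x, y, hxy⟩ := Nat.eq_sq_add_sq_of_isSquare_mod_neg_one hsq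
  exact ⟨x, y, 1, by simp, by rw [hxy]; push_cast; ring⟩

theorem legendre_criterion (x1 x2 x3 : ℤ)
    (hx1 : 0 < x1) (hx2 : 0 < x2) (hx3 : 0 < x3)
    (hsq1 : Squarefree x1) (hsq2 : Squarefree x2) (hsq3 : Squarefree x3)
    (hco12 : Int.gcd x1 x2 = 1) (hco13 : Int.gcd x1 x3 = 1) (hco23 : Int.gcd x2 x3 = 1) :
    (∃ y1 y2 y3 : ℤ, (y1, y2, y3) ≠ (0, 0, 0) ∧
        x1 * y1 ^ 2 + x2 * y2 ^ 2 = x3 * y3 ^ 2) ↔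
      (IsSquareMod (x2 * x3) x1 ∧ IsSquareMod (x1 * x3) x2 ∧
        IsSquareMod (-(x1 * x2)) x3) := by
  rw [← Int.isCoprime_iff_gcd_eq_one] at hco12 hco13 hco23
  constructor
  · rintro ⟨y1, y2, y3, hne, h⟩
    refine ⟨?_, ?_, ?_⟩
    · have := isSquareMod_of_zero (b := x2) (c := -x3) hsq1 hco13.neg_right hne
        (by linear_combination h)
      rwa [mul_neg, neg_neg] at this
    · have := isSquareMod_of_zero (b := x1) (c := -x3) (x := y2) (y := y1) (z := y3) hsq2
        hco23.neg_right (by simp only [ne_eq, Prod.mk.injEq] at hne ⊢; tauto)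
        (by linear_combination h)
      rwa [mul_neg, neg_neg] at this
    · have := isSquareMod_of_zero (b := -x1) (c := -x2) (x := y3) (y := y1) (z := y2) hsq3
        hco23.symm.neg_right (by simp only [ne_eq, Prod.mk.injEq] at hne ⊢; tauto)
        (by linear_combination -h)
      rwa [neg_mul_neg] at this
  · rintro ⟨⟨r, hr⟩, ⟨s, hs⟩, ⟨t, ht⟩⟩
    by_cases h11 : x1 = 1 ∧ x2 = 1
    · obtain ⟨rfl, rfl⟩ := h11
      simpa using exists_zero_of_isSquareMod_neg_one hx3 ⟨t, by simpa using ht⟩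
    obtain ⟨x, y, z, hne, hx, hy, hz, h1, h2, h3⟩ : ∃ x y z : ℤ, (x, y, z) ≠ (0, 0, 0) ∧
        x ^ 2 ≤ x2 * x3 ∧ y ^ 2 ≤ x1 * x3 ∧ z ^ 2 ≤ x1 * x2 ∧
        x1 ∣ r * y - x3 * z ∧ x2 ∣ s * x - x3 * z ∧ x3 ∣ x1 * x - t * y := by
      lift x1 to ℕ using hx1.le
      lift x2 to ℕ using hx2.le
      lift x3 to ℕ using hx3.le
      have : NeZero x1 := ⟨by omega⟩
      have : NeZero x2 := ⟨by omega⟩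
      have : NeZero x3 := ⟨by omega⟩
      exact exists_small_solution x1 x2 x3 r x3 s x3 x1 t
    set f := x1 * x ^ 2 + x2 * y ^ 2 - x3 * z ^ 2 with hf
    have d1 : x1 ∣ f := by
      refine hco13.dvd_of_dvd_mul_left ?_
      have : x3 * f = x1 * (x3 * x ^ 2) - (r ^ 2 - x2 * x3) * y ^ 2
          + (r * y - x3 * z) * (r * y + x3 * z) := by rw [hf]; ring
      rw [this]
      exact dvd_add (dvd_sub (dvd_mul_right _ _) (hr.mul_right _)) (h1.mul_right _)
    have d2 : x2 ∣ f := by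
      refine hco23.dvd_of_dvd_mul_left ?_
      have : x3 * f = x2 * (x3 * y ^ 2) - (s ^ 2 - x1 * x3) * x ^ 2
          + (s * x - x3 * z) * (s * x + x3 * z) := by rw [hf]; ring
      rw [this]
      exact dvd_add (dvd_sub (dvd_mul_right _ _) (hs.mul_right _)) (h2.mul_right _)
    have d3 : x3 ∣ f := by
      refine hco13.symm.dvd_of_dvd_mul_left ?_
      have : x1 * f = (t ^ 2 - -(x1 * x2)) * y ^ 2 - x3 * (x1 * z ^ 2)
          + (x1 * x - t * y) * (x1 * x + t * y) := by rw [hf]; ring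
      rw [this]
      exact dvd_add (dvd_sub (ht.mul_right _) (dvd_mul_right _ _)) (h3.mul_right _)
    obtain ⟨k, hk⟩ : x1 * x2 * x3 ∣ f :=
      (hco13.mul_left hco23).mul_dvd (hco12.mul_dvd d1 d2) d3
    have hz' : z ^ 2 < x1 * x2 := lt_of_le_of_ne hz fun h =>
      h11 (eq_one_of_sq_eq_mul hx1 hx2 hsq1 hsq2 hco12 h)
    have hxy : x ^ 2 < x2 * x3 ∨ y ^ 2 < x1 * x3 := by
      by_contra! hcon
      exact h11 ⟨(eq_one_of_sq_eq_mul hx1 hx3 hsq1 hsq3 hco13 (le_antisymm hy hcon.2)).1,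
        (eq_one_of_sq_eq_mul hx2 hx3 hsq2 hsq3 hco23 (le_antisymm hx hcon.1)).1⟩
    have hpos : 0 < x1 * x2 * x3 := by positivity
    have bx : x1 * x ^ 2 ≤ x1 * x2 * x3 := by nlinarith
    have bY : x2 * y ^ 2 ≤ x1 * x2 * x3 := by nlinarith
    have bz : x3 * z ^ 2 < x1 * x2 * x3 := by nlinarith
    have hxy' : x1 * x ^ 2 + x2 * y ^ 2 < 2 * (x1 * x2 * x3) := by
      rcases hxy with h | h
      · have : x1 * x ^ 2 < x1 * x2 * x3 := by nlinarith
        linarith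
      · have : x2 * y ^ 2 < x1 * x2 * x3 := by nlinarith
        linarith
    have nx : 0 ≤ x1 * x ^ 2 := by positivity
    have ny : 0 ≤ x2 * y ^ 2 := by positivity
    have nz : 0 ≤ x3 * z ^ 2 := by positivity
    have k0 : -1 < k := by
      refine lt_of_mul_lt_mul_left (a := x1 * x2 * x3) ?_ hpos.le
      linarith
    have k1 : k < 2 := by
      refine lt_of_mul_lt_mul_left (a := x1 * x2 * x3) ?_ hpos.le
      linarith
    obtain rfl | rfl : k = 0 ∨ k = 1 := by omega
    · exact ⟨x, y, z, hne, by linarith⟩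
    · exact exists_zero_of_eq_mul hx1 hx2 (hk.trans (mul_one _))
end

section
/- There exist constants C > 0 and T0 ≥ 2 such that for all T ≥ T0, the number of tuples (x1, x2, x3, y1, y2, y3) counted by N(T) which in addition satisfy |y1*y2*y3| ≤ T^(1/2) is at most C * T^(1/2) * (log T)^3. -/
open Real

/-- The conditions defining the tuples counted by `N(T)`. -/
def StackyCounted (T : ℝ) (x1 x2 x3 y1 y2 y3 : ℤ) : Prop :=
  x1 ≠ 0 ∧ x2 ≠ 0 ∧ x3 ≠ 0 ∧ y1 ≠ 0 ∧ y2 ≠ 0 ∧ y3 ≠ 0 ∧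
  Int.gcd x1 x2 = 1 ∧ Int.gcd x1 x3 = 1 ∧ Int.gcd x2 x3 = 1 ∧
  Int.gcd y1 y2 = 1 ∧ Int.gcd y1 y3 = 1 ∧ Int.gcd y2 y3 = 1 ∧
  Squarefree x1 ∧ Squarefree x2 ∧ Squarefree x3 ∧
  x1 * y1 ^ 2 + x2 * y2 ^ 2 = x3 * y3 ^ 2 ∧
  0 < x1 ∧ |x2 * y2 ^ 2| ≤ x1 * y1 ^ 2 ∧
  ((|(x1 * y1) ^ 2 * x2 * x3| : ℤ) : ℝ) ≤ T

/-- The number of tuples counted by `N(T)` which moreover satisfy `|y1*y2*y3| ≤ √T`. -/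
noncomputable def stackyNsmallY (T : ℝ) : ℕ :=
  Set.ncard {v : ℤ × ℤ × ℤ × ℤ × ℤ × ℤ |
    StackyCounted T v.1 v.2.1 v.2.2.1 v.2.2.2.1 v.2.2.2.2.1 v.2.2.2.2.2 ∧
    ((|v.2.2.2.1 * v.2.2.2.2.1 * v.2.2.2.2.2| : ℤ) : ℝ) ≤ Real.sqrt T}

/-- A finite family of reals in `[a, b]` with pairwise gaps at least `δ` has at most
`1 + (b - a) / δ` members. -/
lemma card_le_of_separated {ι : Type*} (s : Finset ι) (f : ι → ℝ) {a b δ : ℝ} (hδ : 0 < δ)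
    (hab : a ≤ b) (hf : ∀ i ∈ s, a ≤ f i ∧ f i ≤ b)
    (hsep : ∀ i ∈ s, ∀ j ∈ s, i ≠ j → δ ≤ |f i - f j|) :
    (s.card : ℝ) ≤ 1 + (b - a) / δ := by
  have hcard : s.card ≤ (Finset.range (⌊(b - a) / δ⌋₊ + 1)).card := by
    refine Finset.card_le_card_of_injOn (fun i => ⌊(f i - a) / δ⌋₊) ?_ ?_
    · intro i hi
      have := hf i hi
      simp only [Finset.coe_range, Set.mem_Iio, Nat.lt_succ_iff]
      exact Nat.floor_le_floor (by gcongr; exact this.2)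
    · intro i hi j hj hij
      by_contra hne
      have h := hsep i hi j hj hne
      have hi0 : 0 ≤ (f i - a) / δ := div_nonneg (by linarith [(hf i hi).1]) hδ.le
      have hj0 : 0 ≤ (f j - a) / δ := div_nonneg (by linarith [(hf j hj).1]) hδ.le
      have h1 := Nat.floor_le hi0
      have h2 := Nat.lt_floor_add_one ((f i - a) / δ)
      have h3 := Nat.floor_le hj0
      have h4 := Nat.lt_floor_add_one ((f j - a) / δ)
      simp only at hij
      rw [hij] at h1 h2
      have h5 : |(f i - a) / δ - (f j - a) / δ| < 1 := by
        rw [abs_lt]; constructor <;> linarith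
      rw [← sub_div, abs_div, abs_of_pos hδ, div_lt_one hδ] at h5
      have : f i - a - (f j - a) = f i - f j := by ring
      rw [this] at h5
      linarith
  rw [Finset.card_range] at hcard
  have h1 : (s.card : ℝ) ≤ (⌊(b - a) / δ⌋₊ : ℝ) + 1 := by exact_mod_cast hcard
  have h2 := Nat.floor_le (div_nonneg (sub_nonneg.2 hab) hδ.le)
  linarith

/-- A geometric sequence of ratio `4`, folded at `1`, has bounded sum. -/
lemma sum_min_geometric_le {τ : ℝ} (hτ : 0 < τ) (K : ℕ) :
    ∑ k ∈ Finset.range K, min (4 ^ k * τ) (1 / (4 ^ k * τ)) ≤ 10 / 3 := by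
  set g : ℕ → ℝ := fun k => 10 / 3 * (4 ^ k * τ / (1 + 4 ^ k * τ)) with hg
  have step : ∀ k, min (4 ^ k * τ) (1 / (4 ^ k * τ)) ≤ g (k + 1) - g k := by
    intro k
    have hx : 0 < 4 ^ k * τ := by positivity
    simp only [hg, pow_succ]
    rw [show (4 : ℝ) ^ k * 4 * τ = 4 * (4 ^ k * τ) by ring]
    generalize (4 : ℝ) ^ k * τ = x at hx
    have e : 10 / 3 * (4 * x / (1 + 4 * x)) - 10 / 3 * (x / (1 + x))
        = 10 * x / ((1 + 4 * x) * (1 + x)) := by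
      field_simp
      ring
    rw [e]
    rcases le_total x 1 with h | h
    · refine (min_le_left _ _).trans ?_
      rw [le_div_iff₀ (by positivity)]
      nlinarith [mul_nonneg hx.le (sub_nonneg.2 h), mul_pos hx hx]
    · refine (min_le_right _ _).trans ?_
      rw [div_le_div_iff₀ hx (by positivity)]
      nlinarith
  calc ∑ k ∈ Finset.range K, min (4 ^ k * τ) (1 / (4 ^ k * τ))
      ≤ ∑ k ∈ Finset.range K, (g (k + 1) - g k) := Finset.sum_le_sum fun k _ => step k
    _ = g K - g 0 := Finset.sum_range_sub g K
    _ ≤ 10 / 3 := by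
        have h0 : 0 ≤ g 0 := by simp only [hg]; positivity
        have h1 : g K ≤ 10 / 3 := by
          simp only [hg]
          have : 4 ^ K * τ / (1 + 4 ^ K * τ) ≤ 1 := by
            rw [div_le_one (by positivity)]; linarith
          linarith
        linarith

/-- The triples `x` on the conic attached to `y` of bounded height whose third term is large. -/
def ConicPoint (T : ℝ) (y1 y2 y3 : ℤ) (x : ℤ × ℤ × ℤ) : Prop :=
  0 < x.1 ∧ x.2.1 ≠ 0 ∧ x.2.2 ≠ 0 ∧ Int.gcd x.1 x.2.1 = 1 ∧
  x.1 * y1 ^ 2 + x.2.1 * y2 ^ 2 = x.2.2 * y3 ^ 2 ∧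
  |x.2.1| * y2 ^ 2 ≤ 2 * (x.1 * y1 ^ 2) ∧ x.1 * y1 ^ 2 ≤ 2 * (|x.2.2| * y3 ^ 2) ∧
  (((x.1 * y1) ^ 2 * |x.2.1| * |x.2.2| : ℤ) : ℝ) ≤ T

lemma ConicPoint.sq_le_abs_det {T : ℝ} {y1 y2 y3 : ℤ} {x w : ℤ × ℤ × ℤ} (h3 : y3 ≠ 0)
    (h13 : Int.gcd y1 y3 = 1) (hx : ConicPoint T y1 y2 y3 x) (hw : ConicPoint T y1 y2 y3 w)
    (hne : x ≠ w) : y3 ^ 2 ≤ |x.2.1 * w.1 - w.2.1 * x.1| := by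
  obtain ⟨x1, x2, x3⟩ := x
  obtain ⟨w1, w2, w3⟩ := w
  obtain ⟨hx1, -, -, hxg, hxe, -⟩ := hx
  obtain ⟨hw1, -, -, hwg, hwe, -⟩ := hw
  simp only at *
  have hdvd : y3 ^ 2 ∣ x2 * w1 - w2 * x1 := by
    have hc : IsCoprime (y3 ^ 2) (y1 ^ 2) := (Int.isCoprime_iff_gcd_eq_one.2 h13).symm.pow
    refine hc.dvd_of_dvd_mul_right ⟨x2 * w3 - w2 * x3, ?_⟩
    linear_combination x2 * hwe - w2 * hxe
  refine Int.le_of_dvd (abs_pos.2 fun h0 => hne ?_) ((dvd_abs _ _).2 hdvd)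
  have hxc := Int.isCoprime_iff_gcd_eq_one.2 hxg
  have hwc := Int.isCoprime_iff_gcd_eq_one.2 hwg
  have d1 : x1 ∣ w1 := hxc.dvd_of_dvd_mul_left ⟨w2, by linarith⟩
  have d2 : w1 ∣ x1 := hwc.dvd_of_dvd_mul_left ⟨x2, by linarith⟩
  have e1 : x1 = w1 := le_antisymm (Int.le_of_dvd hw1 d1) (Int.le_of_dvd hx1 d2)
  subst e1
  have e2 : x2 = w2 := mul_right_cancel₀ hx1.ne' (by linarith)
  subst e2
  have e3 : x3 = w3 := mul_right_cancel₀ (pow_ne_zero 2 h3) (hxe.symm.trans hwe)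
  rw [e3]

lemma card_conicPoint_dyadic_le {T X : ℝ} (hT : 0 < T) (hX : 0 < X) {y1 y2 y3 : ℤ}
    (h1 : y1 ≠ 0) (h2 : y2 ≠ 0) (h3 : y3 ≠ 0) (h13 : Int.gcd y1 y3 = 1)
    (s : Finset (ℤ × ℤ × ℤ)) (hs : ∀ x ∈ s, ConicPoint T y1 y2 y3 x)
    (hsX : ∀ x ∈ s, X ≤ x.1 ∧ (x.1 : ℝ) ≤ 2 * X) :
    (s.card : ℝ) ≤ 1 + 16 * min (X ^ 2 * y1 ^ 2 / (y2 ^ 2 * y3 ^ 2)) (T / (X ^ 2 * y1 ^ 4)) := by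
  have r1 : (0 : ℝ) < y1 ^ 2 := by have : (y1 : ℝ) ≠ 0 := by exact_mod_cast h1
                                   positivity
  have r2 : (0 : ℝ) < y2 ^ 2 := by have : (y2 : ℝ) ≠ 0 := by exact_mod_cast h2
                                   positivity
  have r3 : (0 : ℝ) < y3 ^ 2 := by have : (y3 : ℝ) ≠ 0 := by exact_mod_cast h3
                                   positivity
  have key : ∀ R : ℝ, 0 ≤ R → (∀ x ∈ s, |(x.2.1 : ℝ) / x.1| ≤ R) →
      (s.card : ℝ) ≤ 1 + 8 * R * X ^ 2 / y3 ^ 2 := by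
    intro R hR hb
    have := card_le_of_separated s (fun x => (x.2.1 : ℝ) / x.1) (a := -R) (b := R)
      (δ := y3 ^ 2 / (4 * X ^ 2)) (by positivity) (by linarith)
      (fun x hx => abs_le.1 (hb x hx)) ?_
    · refine this.trans (le_of_eq ?_)
      field_simp
      ring
    · intro x hx w hw hne
      have hd := (hs x hx).sq_le_abs_det h3 h13 (hs w hw) hne
      have hd' : (y3 : ℝ) ^ 2 ≤ |(x.2.1 : ℝ) * w.1 - w.2.1 * x.1| := by exact_mod_cast hd
      have px : 0 < (x.1 : ℝ) := hX.trans_le (hsX x hx).1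
      have pw : 0 < (w.1 : ℝ) := hX.trans_le (hsX w hw).1
      have e : (x.2.1 : ℝ) / x.1 - w.2.1 / w.1 = (x.2.1 * w.1 - w.2.1 * x.1) / (x.1 * w.1) := by
        field_simp
      rw [e, abs_div, abs_of_pos (mul_pos px pw)]
      refine div_le_div₀ (abs_nonneg _) hd' (mul_pos px pw) ?_
      nlinarith [(hsX x hx).2, (hsX w hw).2]
  rw [mul_min_of_nonneg _ _ (by norm_num : (0 : ℝ) ≤ 16), ← min_add_add_left]
  refine le_min ?_ ?_
  · refine (key (2 * y1 ^ 2 / y2 ^ 2) (by positivity) ?_).trans (le_of_eq ?_)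
    · intro x hx
      obtain ⟨hx1, -, -, -, -, hb, -⟩ := hs x hx
      have hb' : |(x.2.1 : ℝ)| * y2 ^ 2 ≤ 2 * (x.1 * y1 ^ 2) := by exact_mod_cast hb
      have px : 0 < (x.1 : ℝ) := by exact_mod_cast hx1
      rw [abs_div, abs_of_pos px, div_le_div_iff₀ px r2]
      linarith
    · field_simp
      ring
  · refine (key (2 * T * y3 ^ 2 / (X ^ 4 * y1 ^ 4)) (by positivity) ?_).trans (le_of_eq ?_)
    · intro x hx
      obtain ⟨hx1, -, -, -, -, -, hb, hT'⟩ := hs x hx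
      have hb' : (x.1 : ℝ) * y1 ^ 2 ≤ 2 * (|(x.2.2 : ℝ)| * y3 ^ 2) := by exact_mod_cast hb
      have hT'' : ((x.1 : ℝ) * y1) ^ 2 * |(x.2.1 : ℝ)| * |(x.2.2 : ℝ)| ≤ T := by
        exact_mod_cast hT'
      have px : 0 < (x.1 : ℝ) := by exact_mod_cast hx1
      have hXx := (hsX x hx).1
      have r4 : (0 : ℝ) < y1 ^ 4 := by
        have := pow_pos r1 2
        nlinarith
      rw [abs_div, abs_of_pos px, div_le_div_iff₀ px (by positivity)]
      have i1 : |(x.2.1 : ℝ)| * (X ^ 4 * y1 ^ 4) ≤ |(x.2.1 : ℝ)| * ((x.1 : ℝ) ^ 4 * y1 ^ 4) := by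
        gcongr
      have i2 : ((x.1 : ℝ) * y1) ^ 2 * |(x.2.1 : ℝ)| * x.1 * (x.1 * y1 ^ 2) ≤
          ((x.1 : ℝ) * y1) ^ 2 * |(x.2.1 : ℝ)| * x.1 * (2 * (|(x.2.2 : ℝ)| * y3 ^ 2)) :=
        mul_le_mul_of_nonneg_left hb' (by positivity)
      have i3 := mul_le_mul_of_nonneg_right hT'' (by positivity : 0 ≤ 2 * (x.1 : ℝ) * y3 ^ 2)
      calc |(x.2.1 : ℝ)| * (X ^ 4 * y1 ^ 4)
          ≤ |(x.2.1 : ℝ)| * ((x.1 : ℝ) ^ 4 * y1 ^ 4) := i1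
        _ = ((x.1 : ℝ) * y1) ^ 2 * |(x.2.1 : ℝ)| * x.1 * (x.1 * y1 ^ 2) := by ring
        _ ≤ _ := i2
        _ = ((x.1 : ℝ) * y1) ^ 2 * |(x.2.1 : ℝ)| * |(x.2.2 : ℝ)| * (2 * x.1 * y3 ^ 2) := by ring
        _ ≤ _ := i3
        _ = _ := by ring
    · have : (y1 : ℝ) ≠ 0 := by exact_mod_cast h1
      field_simp
      ring

lemma card_conicPoint_le {T : ℝ} (hT : 0 < T) {y1 y2 y3 : ℤ}
    (h1 : y1 ≠ 0) (h2 : y2 ≠ 0) (h3 : y3 ≠ 0) (h13 : Int.gcd y1 y3 = 1) (K : ℕ)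
    (s : Finset (ℤ × ℤ × ℤ)) (hs : ∀ x ∈ s, ConicPoint T y1 y2 y3 x)
    (hK : ∀ x ∈ s, x.1 < 2 ^ K) :
    (s.card : ℝ) ≤ K + 160 / 3 * (√T / |(y1 * y2 * y3 : ℝ)|) := by
  have r1 : 0 < |(y1 : ℝ)| := abs_pos.2 (by exact_mod_cast h1)
  have r2 : 0 < |(y2 : ℝ)| := abs_pos.2 (by exact_mod_cast h2)
  have r3 : 0 < |(y3 : ℝ)| := abs_pos.2 (by exact_mod_cast h3)
  have hq : 0 < √T := Real.sqrt_pos.2 hT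
  set τ : ℝ := |(y1 : ℝ)| ^ 3 / (√T * |(y2 : ℝ)| * |(y3 : ℝ)|) with hτ
  have hτ0 : 0 < τ := by positivity
  set Q : ℝ := √T / |(y1 * y2 * y3 : ℝ)| with hQ
  have hQ0 : 0 ≤ Q := by positivity
  have hmaps : ∀ x ∈ s, Nat.log 2 x.1.toNat ∈ Finset.range K := by
    intro x hx
    have hx1 := (hs x hx).1
    rw [Finset.mem_range]
    refine Nat.log_lt_of_lt_pow (by omega) ?_
    have := hK x hx
    zify
    rw [Int.toNat_of_nonneg hx1.le]
    exact this
  have hpiece : ∀ k ∈ Finset.range K,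
      ((s.filter fun x => Nat.log 2 x.1.toNat = k).card : ℝ) ≤
        1 + 16 * Q * min (4 ^ k * τ) (1 / (4 ^ k * τ)) := by
    intro k _
    refine (card_conicPoint_dyadic_le hT (X := 2 ^ k) (by positivity) h1 h2 h3 h13 _
      (fun x hx => hs x (Finset.mem_filter.1 hx).1) ?_).trans (le_of_eq ?_)
    · intro x hx
      obtain ⟨hxs, hxk⟩ := Finset.mem_filter.1 hx
      have hx1 := (hs x hxs).1
      have l1 : 2 ^ k ≤ x.1.toNat := by
        rw [← hxk]; exact Nat.pow_log_le_self 2 (by omega)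
      have l2 : x.1.toNat < 2 ^ (k + 1) := by
        rw [← hxk]; exact Nat.lt_pow_succ_log_self (by norm_num) _
      have c : ((x.1.toNat : ℕ) : ℝ) = (x.1 : ℝ) := by
        exact_mod_cast congrArg (Int.cast : ℤ → ℝ) (Int.toNat_of_nonneg hx1.le)
      rw [← c]
      constructor
      · exact_mod_cast l1
      · rw [← pow_succ']
        exact_mod_cast l2.le
    · rw [mul_assoc 16 Q, mul_min_of_nonneg _ _ hQ0]
      have hp : ((2 : ℝ) ^ k) ^ 2 = 4 ^ k := by
        rw [← pow_mul, mul_comm, pow_mul]; norm_num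
      have e4 : (y1 : ℝ) ^ 4 = |(y1 : ℝ)| ^ 4 := by
        rw [show (4 : ℕ) = 2 * 2 from rfl, pow_mul, pow_mul, sq_abs]
      rw [hp, ← sq_abs (y1 : ℝ), ← sq_abs (y2 : ℝ), ← sq_abs (y3 : ℝ), e4]
      simp only [hQ, hτ, abs_mul]
      generalize |(y1 : ℝ)| = a at *
      generalize |(y2 : ℝ)| = b at *
      generalize |(y3 : ℝ)| = c at *
      have hTT : √T * √T = T := Real.mul_self_sqrt hT.le
      congr 3
      · field_simp
      · conv_lhs => rw [← hTT]
        field_simp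
  rw [Finset.card_eq_sum_card_fiberwise hmaps]
  push_cast
  calc ∑ k ∈ Finset.range K, ((s.filter fun x => Nat.log 2 x.1.toNat = k).card : ℝ)
      ≤ ∑ k ∈ Finset.range K, (1 + 16 * Q * min (4 ^ k * τ) (1 / (4 ^ k * τ))) :=
        Finset.sum_le_sum hpiece
    _ = K + 16 * Q * ∑ k ∈ Finset.range K, min (4 ^ k * τ) (1 / (4 ^ k * τ)) := by
        rw [Finset.sum_add_distrib, ← Finset.mul_sum]
        simp
    _ ≤ K + 16 * Q * (10 / 3) := by
        gcongr
        exact sum_min_geometric_le hτ0 K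
    _ = _ := by ring

lemma card_stackyCounted_le {T : ℝ} (hT : 0 < T) {y1 y2 y3 : ℤ} (K : ℕ)
    (s : Finset (ℤ × ℤ × ℤ)) (hs : ∀ x ∈ s, StackyCounted T x.1 x.2.1 x.2.2 y1 y2 y3)
    (hK : ∀ x ∈ s, x.1 < 2 ^ K) :
    (s.card : ℝ) ≤ 2 * K + 320 / 3 * (√T / |(y1 * y2 * y3 : ℝ)|) := by
  classical
  rcases s.eq_empty_or_nonempty with rfl | ⟨x0, hx0⟩
  · simp only [Finset.card_empty, Nat.cast_zero]
    positivity
  obtain ⟨-, -, -, h1, h2, h3, -, -, -, h12, h13, -⟩ := hs x0 hx0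
  set p : ℤ × ℤ × ℤ → Prop := fun x => x.1 * y1 ^ 2 ≤ 2 * (|x.2.2| * y3 ^ 2) with hp
  have hA := card_conicPoint_le hT h1 h2 h3 h13 K (s.filter p) ?_
    fun x hx => hK x (Finset.mem_filter.1 hx).1
  · have hB := card_conicPoint_le hT h1 h3 h2 h12 K
      ((s.filter fun x => ¬ p x).image fun x => (x.1, -x.2.2, -x.2.1)) ?_ ?_
    · rw [Finset.card_image_of_injective] at hB
      · have hc := Finset.card_filter_add_card_filter_not (s := s) p
        have hc' : (s.card : ℝ) = (s.filter p).card + (s.filter fun x => ¬ p x).card := by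
          exact_mod_cast hc.symm
        have e : (y1 * y3 * y2 : ℝ) = y1 * y2 * y3 := by ring
        rw [e] at hB
        rw [hc']
        linarith
      · rintro ⟨a, b, c⟩ ⟨a', b', c'⟩ h
        simp only [Prod.mk.injEq, neg_inj] at h ⊢
        tauto
    · intro z hz
      obtain ⟨x, hx, rfl⟩ := Finset.mem_image.1 hz
      obtain ⟨hxs, hnp⟩ := Finset.mem_filter.1 hx
      obtain ⟨-, n2, n3, -, -, -, g12, g13, -, -, -, -, -, -, -, he, hpos, hle, hht⟩ := hs x hxs
      simp only [hp, not_le] at hnp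
      have y1p : 0 < x.1 * y1 ^ 2 := by positivity
      rw [abs_mul, abs_of_nonneg (sq_nonneg y2)] at hle
      refine ⟨hpos, by simpa using n3, by simpa using n2, by simpa using g13, ?_, ?_, ?_, ?_⟩
      · simp only
        linear_combination he
      · simp only [abs_neg]
        nlinarith [abs_nonneg x.2.2, sq_nonneg y3]
      · simp only [abs_neg]
        have := abs_add_le (x.2.2 * y3 ^ 2) (-(x.2.1 * y2 ^ 2))
        rw [abs_neg, abs_mul, abs_mul, abs_of_nonneg (sq_nonneg y2),
          abs_of_nonneg (sq_nonneg y3), ← sub_eq_add_neg, ← he, add_sub_cancel_right,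
          abs_of_pos y1p] at this
        linarith
      · simp only [abs_neg]
        rw [abs_mul, abs_mul, abs_of_nonneg (sq_nonneg _)] at hht
        rwa [mul_right_comm]
    · intro z hz
      obtain ⟨x, hx, rfl⟩ := Finset.mem_image.1 hz
      exact hK x (Finset.mem_filter.1 hx).1
  · intro x hx
    obtain ⟨hxs, hpx⟩ := Finset.mem_filter.1 hx
    obtain ⟨-, n2, n3, -, -, -, g12, -, -, -, -, -, -, -, -, he, hpos, hle, hht⟩ := hs x hxs
    rw [abs_mul, abs_of_nonneg (sq_nonneg y2)] at hle
    rw [abs_mul, abs_mul, abs_of_nonneg (sq_nonneg _)] at hht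
    have y1p : 0 < x.1 * y1 ^ 2 := by positivity
    exact ⟨hpos, n2, n3, g12, he, by linarith, hpx, hht⟩

/-- The nonzero integers of absolute value at most `M`. -/
noncomputable def nonzeroIcc (M : ℕ) : Finset ℤ := (Finset.Icc (-(M : ℤ)) M).filter (· ≠ 0)

lemma mem_nonzeroIcc {M : ℕ} {y : ℤ} : y ∈ nonzeroIcc M ↔ |y| ≤ M ∧ y ≠ 0 := by
  simp [nonzeroIcc, abs_le]

lemma nonzeroIcc_eq (M : ℕ) : nonzeroIcc M =
    (Finset.Icc 1 M).image (fun n : ℕ => (n : ℤ)) ∪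
      (Finset.Icc 1 M).image (fun n : ℕ => -(n : ℤ)) := by
  ext y
  simp only [mem_nonzeroIcc, Finset.mem_union, Finset.mem_image, Finset.mem_Icc]
  constructor
  · rintro ⟨h, h0⟩
    rw [abs_le] at h
    rcases lt_or_gt_of_ne h0 with hy | hy
    · exact Or.inr ⟨y.natAbs, by omega, by omega⟩
    · exact Or.inl ⟨y.natAbs, by omega, by omega⟩
  · rintro (⟨n, hn, rfl⟩ | ⟨n, hn, rfl⟩) <;> rw [abs_le] <;> omega

lemma card_nonzeroIcc_le (M : ℕ) : (nonzeroIcc M).card ≤ 2 * M := by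
  rw [nonzeroIcc_eq]
  refine (Finset.card_union_le _ _).trans ?_
  have h1 := Finset.card_image_le (s := Finset.Icc 1 M) (f := fun n : ℕ => (n : ℤ))
  have h2 := Finset.card_image_le (s := Finset.Icc 1 M) (f := fun n : ℕ => -(n : ℤ))
  simp only [Nat.card_Icc, add_tsub_cancel_right] at h1 h2
  omega

lemma sum_inv_abs_nonzeroIcc_le (M : ℕ) :
    ∑ y ∈ nonzeroIcc M, 1 / |(y : ℝ)| ≤ 2 * (1 + Real.log M) := by
  have hH : ∑ n ∈ Finset.Icc 1 M, 1 / (n : ℝ) ≤ 1 + Real.log M := by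
    have := harmonic_le_one_add_log M
    rw [harmonic_eq_sum_Icc] at this
    push_cast at this
    simpa [one_div] using this
  have hinter : 0 ≤ ∑ y ∈ (Finset.Icc 1 M).image (fun n : ℕ => (n : ℤ)) ∩
      (Finset.Icc 1 M).image (fun n : ℕ => -(n : ℤ)), 1 / |(y : ℝ)| :=
    Finset.sum_nonneg fun _ _ => by positivity
  have hu := Finset.sum_union_inter (s₁ := (Finset.Icc 1 M).image (fun n : ℕ => (n : ℤ)))
    (s₂ := (Finset.Icc 1 M).image (fun n : ℕ => -(n : ℤ))) (f := fun y : ℤ => 1 / |(y : ℝ)|)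
  rw [Finset.sum_image (fun a _ b _ h => by simpa using h),
    Finset.sum_image (fun a _ b _ h => by simpa using h)] at hu
  simp only [Int.cast_neg, Int.cast_natCast, abs_neg, Nat.abs_cast] at hu
  rw [nonzeroIcc_eq]
  linarith

/-- The nonzero integer triples of bounded product. -/
noncomputable def boundedTriples (R : ℝ) : Finset (ℤ × ℤ × ℤ) :=
  (nonzeroIcc ⌊R⌋₊ ×ˢ nonzeroIcc ⌊R⌋₊ ×ˢ nonzeroIcc ⌊R⌋₊).filter
    fun y => |(y.1 * y.2.1 * y.2.2 : ℝ)| ≤ R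

lemma mem_boundedTriples {R : ℝ} {y : ℤ × ℤ × ℤ} : y ∈ boundedTriples R ↔
    (y.1 ∈ nonzeroIcc ⌊R⌋₊ ∧ y.2 ∈ nonzeroIcc ⌊R⌋₊ ×ˢ nonzeroIcc ⌊R⌋₊) ∧
      |(y.1 * y.2.1 * y.2.2 : ℝ)| ≤ R := by
  rw [boundedTriples, Finset.mem_filter, Finset.mem_product]

lemma sum_boundedTriples_le (R : ℝ) :
    ∑ y ∈ boundedTriples R, 1 / |(y.1 * y.2.1 * y.2.2 : ℝ)| ≤
      (∑ y ∈ nonzeroIcc ⌊R⌋₊, 1 / |(y : ℝ)|) ^ 3 := by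
  refine (Finset.sum_le_sum_of_subset_of_nonneg (Finset.filter_subset _ _)
    fun _ _ _ => by positivity).trans (le_of_eq ?_)
  rw [Finset.sum_product, pow_succ', pow_two, Finset.sum_mul_sum, Finset.sum_mul]
  refine Finset.sum_congr rfl fun a _ => ?_
  rw [Finset.sum_product, Finset.mul_sum]
  refine Finset.sum_congr rfl fun b _ => ?_
  rw [Finset.mul_sum]
  refine Finset.sum_congr rfl fun c _ => ?_
  simp only [abs_mul, one_div, mul_inv, mul_assoc]

lemma card_boundedTriples_le {R : ℝ} (hR : 0 ≤ R) :
    ((boundedTriples R).card : ℝ) ≤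
      2 * R * (∑ y ∈ nonzeroIcc ⌊R⌋₊, 1 / |(y : ℝ)|) ^ 2 := by
  classical
  set A := nonzeroIcc ⌊R⌋₊ with hA
  have hmaps : ∀ y ∈ boundedTriples R, y.2 ∈ A ×ˢ A := fun y hy =>
    (mem_boundedTriples.1 hy).1.2
  have hpiece : ∀ z ∈ A ×ˢ A, (((boundedTriples R).filter fun y => y.2 = z).card : ℝ) ≤
      2 * R * (1 / |(z.1 : ℝ)| * (1 / |(z.2 : ℝ)|)) := by
    rintro ⟨b, c⟩ hz
    obtain ⟨hb, hc⟩ := Finset.mem_product.1 hz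
    have rb : 0 < |(b : ℝ)| := abs_pos.2 (by exact_mod_cast (mem_nonzeroIcc.1 hb).2)
    have rc : 0 < |(c : ℝ)| := abs_pos.2 (by exact_mod_cast (mem_nonzeroIcc.1 hc).2)
    have hle : ((boundedTriples R).filter fun y => y.2 = (b, c)).card ≤
        (nonzeroIcc ⌊R / (|(b : ℝ)| * |(c : ℝ)|)⌋₊).card := by
      refine Finset.card_le_card_of_injOn (fun y => y.1) ?_ ?_
      · rintro ⟨a, b', c'⟩ hy
        rw [Finset.mem_coe, Finset.mem_filter, mem_boundedTriples, Prod.mk.injEq] at hy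
        obtain ⟨⟨⟨ha, -⟩, hle⟩, rfl, rfl⟩ := hy
        replace ha := (mem_nonzeroIcc.1 ha).2
        refine Finset.mem_coe.2 (mem_nonzeroIcc.2 ⟨?_, ha⟩)
        simp only [abs_mul] at hle
        have h' : |(a : ℝ)| ≤ R / (|(b' : ℝ)| * |(c' : ℝ)|) := by
          rw [le_div_iff₀ (by positivity)]
          linarith
        have h'' : (a.natAbs : ℝ) ≤ R / (|(b' : ℝ)| * |(c' : ℝ)|) := by
          rwa [Nat.cast_natAbs, Int.cast_abs]
        have := Nat.le_floor h''
        simp only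
        rw [Int.abs_eq_natAbs]
        exact_mod_cast this
      · rintro ⟨a, z⟩ hy ⟨a', z'⟩ hy' h
        rw [Finset.mem_coe, Finset.mem_filter] at hy hy'
        exact Prod.ext h (hy.2.trans hy'.2.symm)
    have hle' := hle.trans (card_nonzeroIcc_le _)
    have h0 := Nat.floor_le (show 0 ≤ R / (|(b : ℝ)| * |(c : ℝ)|) by positivity)
    have hle'' : (((boundedTriples R).filter fun y => y.2 = (b, c)).card : ℝ) ≤
        2 * (⌊R / (|(b : ℝ)| * |(c : ℝ)|)⌋₊ : ℝ) := by exact_mod_cast hle'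
    refine hle''.trans ((mul_le_mul_of_nonneg_left h0 (by norm_num)).trans (le_of_eq ?_))
    field_simp
  rw [Finset.card_eq_sum_card_fiberwise hmaps]
  push_cast
  refine (Finset.sum_le_sum hpiece).trans (le_of_eq ?_)
  rw [← Finset.mul_sum, Finset.sum_product, pow_two, Finset.sum_mul_sum]

/-- The coefficient triples in a box compatible with a given `y`. -/
noncomputable def coefficientTriples (T : ℝ) (y : ℤ × ℤ × ℤ) : Finset (ℤ × ℤ × ℤ) := by
  classical
  exact (nonzeroIcc ⌊T⌋₊ ×ˢ nonzeroIcc ⌊T⌋₊ ×ˢ nonzeroIcc ⌊T⌋₊).filter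
    fun x => StackyCounted T x.1 x.2.1 x.2.2 y.1 y.2.1 y.2.2

lemma StackyCounted.of_mem_coefficientTriples {T : ℝ} {x y : ℤ × ℤ × ℤ}
    (h : x ∈ coefficientTriples T y) : StackyCounted T x.1 x.2.1 x.2.2 y.1 y.2.1 y.2.2 := by
  classical
  simp only [coefficientTriples, Finset.mem_filter] at h
  exact h.2

lemma StackyCounted.sq_mul_le {T : ℝ} {x1 x2 x3 y1 y2 y3 : ℤ}
    (h : StackyCounted T x1 x2 x3 y1 y2 y3) : x1 ^ 2 * (|x2| * |x3|) ≤ (⌊T⌋₊ : ℤ) := by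
  obtain ⟨n1, n2, n3, h1, -, -, -, -, -, -, -, -, -, -, -, -, -, -, hht⟩ := h
  have hz : |(x1 * y1) ^ 2 * x2 * x3| ≤ (⌊T⌋₊ : ℤ) := by
    have : (((|(x1 * y1) ^ 2 * x2 * x3|).toNat : ℕ) : ℝ) ≤ T := by
      have c : ((|(x1 * y1) ^ 2 * x2 * x3|).toNat : ℤ) = |(x1 * y1) ^ 2 * x2 * x3| :=
        Int.toNat_of_nonneg (abs_nonneg _)
      rw [← Int.cast_natCast, c]
      exact hht
    have := Nat.le_floor this
    omega
  rw [abs_mul, abs_mul, abs_of_nonneg (sq_nonneg _)] at hz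
  have y1p : 1 ≤ y1 ^ 2 := by have : 0 < y1 ^ 2 := by positivity
                              omega
  refine le_trans ?_ hz
  calc x1 ^ 2 * (|x2| * |x3|) = 1 * (x1 ^ 2 * (|x2| * |x3|)) := (one_mul _).symm
    _ ≤ y1 ^ 2 * (x1 ^ 2 * (|x2| * |x3|)) :=
      mul_le_mul_of_nonneg_right y1p (by positivity)
    _ = _ := by ring

lemma StackyCounted.mem_coefficientTriples {T : ℝ} {x y : ℤ × ℤ × ℤ}
    (h : StackyCounted T x.1 x.2.1 x.2.2 y.1 y.2.1 y.2.2) : x ∈ coefficientTriples T y := by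
  classical
  unfold coefficientTriples
  have hb := h.sq_mul_le
  have p1 : 1 ≤ |x.1| := Int.one_le_abs h.1
  have p2 : 1 ≤ |x.2.1| := Int.one_le_abs h.2.1
  have p3 : 1 ≤ |x.2.2| := Int.one_le_abs h.2.2.1
  rw [← sq_abs] at hb
  have q1 : 1 ≤ |x.1| ^ 2 := one_le_pow₀ p1
  have q23 : 1 ≤ |x.2.1| * |x.2.2| := one_le_mul_of_one_le_of_one_le p2 p3
  refine Finset.mem_filter.2 ⟨Finset.mem_product.2 ⟨mem_nonzeroIcc.2 ⟨?_, h.1⟩,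
    Finset.mem_product.2 ⟨mem_nonzeroIcc.2 ⟨?_, h.2.1⟩, mem_nonzeroIcc.2 ⟨?_, h.2.2.1⟩⟩⟩, h⟩
  · nlinarith
  · nlinarith
  · nlinarith

lemma stackyNsmallY_le_sum {T : ℝ} :
    stackyNsmallY T ≤ ∑ y ∈ boundedTriples √T, (coefficientTriples T y).card := by
  classical
  set U := (boundedTriples √T).biUnion fun y =>
    (coefficientTriples T y).image fun x => (x.1, x.2.1, x.2.2, y) with hU
  have hsub : {v : ℤ × ℤ × ℤ × ℤ × ℤ × ℤ |
      StackyCounted T v.1 v.2.1 v.2.2.1 v.2.2.2.1 v.2.2.2.2.1 v.2.2.2.2.2 ∧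
      ((|v.2.2.2.1 * v.2.2.2.2.1 * v.2.2.2.2.2| : ℤ) : ℝ) ≤ Real.sqrt T} ⊆ ↑U := by
    rintro ⟨x1, x2, x3, y1, y2, y3⟩ ⟨hc, hy⟩
    simp only at hc hy
    obtain ⟨-, -, -, h1, h2, h3, -⟩ := id hc
    refine Finset.mem_coe.2 (Finset.mem_biUnion.2 ⟨(y1, y2, y3), ?_,
      Finset.mem_image.2 ⟨(x1, x2, x3), hc.mem_coefficientTriples, rfl⟩⟩)
    have hz : |y1 * y2 * y3| ≤ (⌊√T⌋₊ : ℤ) := by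
      have : ((y1 * y2 * y3).natAbs : ℝ) ≤ √T := by
        rwa [Nat.cast_natAbs]
      rw [Int.abs_eq_natAbs]
      exact_mod_cast Nat.le_floor this
    rw [abs_mul, abs_mul] at hz
    have p1 : 1 ≤ |y1| := Int.one_le_abs h1
    have p2 : 1 ≤ |y2| := Int.one_le_abs h2
    have p3 : 1 ≤ |y3| := Int.one_le_abs h3
    have q12 : 1 ≤ |y1| * |y2| := one_le_mul_of_one_le_of_one_le p1 p2
    refine mem_boundedTriples.2 ⟨⟨mem_nonzeroIcc.2 ⟨?_, h1⟩,
      Finset.mem_product.2 ⟨mem_nonzeroIcc.2 ⟨?_, h2⟩, mem_nonzeroIcc.2 ⟨?_, h3⟩⟩⟩, ?_⟩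
    · nlinarith
    · nlinarith
    · nlinarith
    · push_cast at hy
      exact hy
  calc stackyNsmallY T ≤ (U : Set (ℤ × ℤ × ℤ × ℤ × ℤ × ℤ)).ncard :=
        Set.ncard_le_ncard hsub (Finset.finite_toSet U)
    _ = U.card := Set.ncard_coe_finset U
    _ ≤ ∑ y ∈ boundedTriples √T, _ := Finset.card_biUnion_le
    _ ≤ _ := Finset.sum_le_sum fun y _ => Finset.card_image_le

theorem stackyN_linear_case_upper :
    ∃ C : ℝ, 0 < C ∧ ∃ T0 : ℝ, 2 ≤ T0 ∧
      ∀ T : ℝ, T0 ≤ T →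
        (stackyNsmallY T : ℝ) ≤ C * Real.sqrt T * (Real.log T) ^ 3 := by
  refine ⟨5000, by norm_num, 3, by norm_num, fun T hT => ?_⟩
  have hT0 : 0 < T := by linarith
  have hlog : 1 ≤ Real.log T := by
    rw [Real.le_log_iff_exp_le hT0]
    linarith [Real.exp_one_lt_three]
  set L := Real.log T with hL
  have hq1 : 1 ≤ √T := Real.one_le_sqrt.2 (by linarith)
  set M := ⌊√T⌋₊ with hM
  have hM1 : 1 ≤ M := Nat.le_floor (by exact_mod_cast hq1)
  have hMr : (M : ℝ) ≤ √T := Nat.floor_le (Real.sqrt_nonneg T)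
  have hlogM : Real.log M ≤ L / 2 := by
    rw [hL, ← Real.log_sqrt hT0.le]
    exact Real.log_le_log (by exact_mod_cast hM1) hMr
  have hsum : ∑ y ∈ nonzeroIcc M, 1 / |(y : ℝ)| ≤ 3 * L :=
    (sum_inv_abs_nonzeroIcc_le M).trans (by linarith)
  have hsum0 : 0 ≤ ∑ y ∈ nonzeroIcc M, 1 / |(y : ℝ)| :=
    Finset.sum_nonneg fun _ _ => by positivity
  set K := Nat.log 2 M + 1 with hK
  have hKL : (K : ℝ) ≤ 2 * L := by
    have h1 : ((2 : ℝ) ^ Nat.log 2 M) ≤ M := by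
      exact_mod_cast Nat.pow_log_le_self 2 (by omega)
    have h2 := Real.log_le_log (by positivity) h1
    rw [Real.log_pow] at h2
    have h3 := Real.log_two_gt_d9
    have h4 : (0 : ℝ) ≤ Nat.log 2 M := by positivity
    rw [hK]
    push_cast
    nlinarith
  have hpiece : ∀ y ∈ boundedTriples √T, ((coefficientTriples T y).card : ℝ) ≤
      2 * K + 320 / 3 * √T * (1 / |(y.1 * y.2.1 * y.2.2 : ℝ)|) := by
    intro y _
    have := card_stackyCounted_le hT0 K (coefficientTriples T y)
      (fun x hx => StackyCounted.of_mem_coefficientTriples hx) ?_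
    · refine this.trans (le_of_eq ?_)
      ring
    · intro x hx
      have hc := StackyCounted.of_mem_coefficientTriples hx
      have hb := hc.sq_mul_le
      have p2 : 1 ≤ |x.2.1| := Int.one_le_abs hc.2.1
      have p3 : 1 ≤ |x.2.2| := Int.one_le_abs hc.2.2.1
      have q23 : 1 ≤ |x.2.1| * |x.2.2| := one_le_mul_of_one_le_of_one_le p2 p3
      have hx2 : x.1 ^ 2 ≤ (⌊T⌋₊ : ℤ) := by nlinarith [sq_nonneg x.1]
      have hx2r : (x.1 : ℝ) ^ 2 ≤ T := by
        have : ((x.1 ^ 2 : ℤ) : ℝ) ≤ ((⌊T⌋₊ : ℤ) : ℝ) := Int.cast_le.2 hx2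
        push_cast at this
        exact this.trans (Nat.floor_le hT0.le)
      have hxpos : 0 < x.1 := hc.2.2.2.2.2.2.2.2.2.2.2.2.2.2.2.2.1
      have hxr : ((x.1.toNat : ℕ) : ℝ) ≤ √T := by
        have c : ((x.1.toNat : ℕ) : ℝ) = (x.1 : ℝ) := by
          exact_mod_cast congrArg (Int.cast : ℤ → ℝ) (Int.toNat_of_nonneg hxpos.le)
        rw [c]
        exact Real.le_sqrt_of_sq_le hx2r
      have hxM : x.1.toNat ≤ M := Nat.le_floor hxr
      have hlt : x.1.toNat < 2 ^ K :=
        hxM.trans_lt (Nat.lt_pow_succ_log_self (by norm_num) _)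
      zify at hlt
      rwa [Int.toNat_of_nonneg hxpos.le] at hlt
  have hcard := card_boundedTriples_le (Real.sqrt_nonneg T)
  have hinv := sum_boundedTriples_le √T
  rw [← hM] at hcard hinv
  have hcard' : ((boundedTriples √T).card : ℝ) ≤ 2 * √T * (3 * L) ^ 2 :=
    hcard.trans (by gcongr)
  have hinv' : ∑ y ∈ boundedTriples √T, 1 / |(y.1 * y.2.1 * y.2.2 : ℝ)| ≤ (3 * L) ^ 3 :=
    hinv.trans (by gcongr)
  have hfirst : (stackyNsmallY T : ℝ) ≤
      ∑ y ∈ boundedTriples √T, ((coefficientTriples T y).card : ℝ) := by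
    exact_mod_cast stackyNsmallY_le_sum
  calc (stackyNsmallY T : ℝ)
      ≤ ∑ y ∈ boundedTriples √T, (2 * K + 320 / 3 * √T * (1 / |(y.1 * y.2.1 * y.2.2 : ℝ)|)) :=
        hfirst.trans (Finset.sum_le_sum hpiece)
    _ = (boundedTriples √T).card * (2 * K) +
          320 / 3 * √T * ∑ y ∈ boundedTriples √T, 1 / |(y.1 * y.2.1 * y.2.2 : ℝ)| := by
        rw [Finset.sum_add_distrib, Finset.sum_const, nsmul_eq_mul, Finset.mul_sum]
    _ ≤ 2 * √T * (3 * L) ^ 2 * (2 * (2 * L)) + 320 / 3 * √T * (3 * L) ^ 3 := by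
        gcongr
    _ = 2952 * √T * L ^ 3 := by ring
    _ ≤ 5000 * √T * L ^ 3 := by
        gcongr
        norm_num
end

section
/- Let T > 0 be real and let x1, x2, x3, y1, y2, y3 be nonzero integers with x1*y1^2 + x2*y2^2 = x3*y3^2, x1 > 0, x1*y1^2 ≥ |x2*y2^2|, and |(x1*y1)^2 * x2 * x3| ≤ T. Then (x1*x2*x3)^4 * (y1*y2*y3)^2 ≤ 2 * T^3. In particular, if moreover |y1*y2*y3| ≥ T^(1/2), then |x1*x2*x3| ≤ 2^(1/4) * T^(1/2). -/
open Real

/-- The product of the three bounds `|x₁x₂x₃ · xᵢyᵢ²| ≤ 2 |(x₁y₁)² x₂x₃|`, where the factor `2` is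
only needed for `i = 3`. -/
theorem pow_four_mul_sq_le_two_mul_abs_pow_three {x1 x2 x3 y1 y2 y3 : ℤ}
    (heq : x1 * y1 ^ 2 + x2 * y2 ^ 2 = x3 * y3 ^ 2) (hge : |x2 * y2 ^ 2| ≤ x1 * y1 ^ 2) :
    (x1 * x2 * x3) ^ 4 * (y1 * y2 * y3) ^ 2 ≤ 2 * |(x1 * y1) ^ 2 * x2 * x3| ^ 3 := by
  have hA : 0 ≤ x1 * y1 ^ 2 := (abs_nonneg _).trans hge
  have hC : |x3 * y3 ^ 2| ≤ 2 * (x1 * y1 ^ 2) := by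
    rw [← heq]
    linarith [abs_add_le (x1 * y1 ^ 2) (x2 * y2 ^ 2), abs_of_nonneg hA]
  calc (x1 * x2 * x3) ^ 4 * (y1 * y2 * y3) ^ 2
      ≤ |(x1 * x2 * x3) ^ 4 * (y1 * y2 * y3) ^ 2| := le_abs_self _
    _ = |x1 * x2 * x3| ^ 3 * (|x1 * y1 ^ 2| * |x2 * y2 ^ 2| * |x3 * y3 ^ 2|) := by
        rw [← abs_pow, ← abs_mul, ← abs_mul, ← abs_mul]
        ring_nf
    _ ≤ |x1 * x2 * x3| ^ 3 * ((x1 * y1 ^ 2) * (x1 * y1 ^ 2) * (2 * (x1 * y1 ^ 2))) := by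
        rw [abs_of_nonneg hA]
        gcongr
    _ = 2 * (|x1 * x2 * x3| * |x1 * y1 ^ 2|) ^ 3 := by
        rw [abs_of_nonneg hA]
        ring
    _ = 2 * |(x1 * y1) ^ 2 * x2 * x3| ^ 3 := by
        rw [← abs_mul]
        ring_nf

theorem quadratic_case_key_inequality
    (T : ℝ) (hT : 0 < T) (x1 x2 x3 y1 y2 y3 : ℤ)
    (hx1 : x1 ≠ 0) (hx2 : x2 ≠ 0) (hx3 : x3 ≠ 0)
    (hy1 : y1 ≠ 0) (hy2 : y2 ≠ 0) (hy3 : y3 ≠ 0)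
    (heq : x1 * y1 ^ 2 + x2 * y2 ^ 2 = x3 * y3 ^ 2)
    (hpos : 0 < x1) (hge : |x2 * y2 ^ 2| ≤ x1 * y1 ^ 2)
    (hht : ((|(x1 * y1) ^ 2 * x2 * x3| : ℤ) : ℝ) ≤ T) :
    (((x1 * x2 * x3) ^ 4 * (y1 * y2 * y3) ^ 2 : ℤ) : ℝ) ≤ 2 * T ^ 3 ∧
      (Real.sqrt T ≤ ((|y1 * y2 * y3| : ℤ) : ℝ) →
        ((|x1 * x2 * x3| : ℤ) : ℝ) ≤ (2 : ℝ) ^ ((1 : ℝ) / 4) * Real.sqrt T) := by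
  have key : (((x1 * x2 * x3) ^ 4 * (y1 * y2 * y3) ^ 2 : ℤ) : ℝ) ≤ 2 * T ^ 3 :=
    calc (((x1 * x2 * x3) ^ 4 * (y1 * y2 * y3) ^ 2 : ℤ) : ℝ)
        ≤ 2 * ((|(x1 * y1) ^ 2 * x2 * x3| : ℤ) : ℝ) ^ 3 := by
          exact_mod_cast pow_four_mul_sq_le_two_mul_abs_pow_three heq hge
      _ ≤ 2 * T ^ 3 := by gcongr
  refine ⟨key, fun hY => ?_⟩
  have hT_le : T ≤ ((|y1 * y2 * y3| : ℤ) : ℝ) ^ 2 := (Real.sqrt_le_left (by positivity)).mp hY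
  have hM : ((|x1 * x2 * x3| : ℤ) : ℝ) ^ 4 ≤ 2 * T ^ 2 := by
    refine le_of_mul_le_mul_right ?_ hT
    calc ((|x1 * x2 * x3| : ℤ) : ℝ) ^ 4 * T
        ≤ ((|x1 * x2 * x3| : ℤ) : ℝ) ^ 4 * ((|y1 * y2 * y3| : ℤ) : ℝ) ^ 2 := by gcongr
      _ = (((x1 * x2 * x3) ^ 4 * (y1 * y2 * y3) ^ 2 : ℤ) : ℝ) := by
          rw [← sq_abs (y1 * y2 * y3), ← Even.pow_abs (by decide : Even 4) (x1 * x2 * x3)]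
          push_cast
          rfl
      _ ≤ 2 * T ^ 2 * T := by linarith
  have hroot : ((2 : ℝ) ^ ((1 : ℝ) / 4)) ^ 4 = 2 := by
    rw [← Real.rpow_natCast, ← Real.rpow_mul (by norm_num)]
    norm_num
  refine le_of_pow_le_pow_left₀ four_ne_zero (by positivity) (hM.trans_eq ?_)
  rw [mul_pow, hroot, show √T ^ 4 = (√T ^ 2) ^ 2 by ring, Real.sq_sqrt hT.le]
end
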